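/- arXiv:2004.04129 — 4 statements merged into one kernel-verified Lean document; each statement's English description precedes it below -/
import Mathlib

section
/- Let g ≥ 5. The hyperbolization homomorphism H : SL(g, Z/4Z) → Sp(2g, Z/4Z), sending a matrix A to the block-diagonal matrix with blocks A and (Aᵀ)⁻¹, induces the zero map on second integral group homology: the image of H₊ : H₂(SL(g, Z/4Z)) → H₂(Sp(2g, Z/4Z)) is trivial. -/
noncomputable section

namespace GpH2

open Finsupp

variable (G : Type) [Group G]

/-- Second boundary map of the bar complex: `(g,h) ↦ [h] - [gh] + [g]`. -/
def d2 : ((G × G) →₀ ℤ) →ₗ[ℤ] (G →₀ ℤ) :=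
  Finsupp.linearCombination ℤ fun p : G × G =>
    Finsupp.single p.2 1 - Finsupp.single (p.1 * p.2) 1 + Finsupp.single p.1 1

/-- Third boundary map of the bar complex:
`(g,h,k) ↦ [(h,k)] - [(gh,k)] + [(g,hk)] - [(g,h)]`. -/
def d3 : ((G × G × G) →₀ ℤ) →ₗ[ℤ] ((G × G) →₀ ℤ) :=
  Finsupp.linearCombination ℤ fun t : G × G × G =>
    Finsupp.single (t.2.1, t.2.2) 1 - Finsupp.single (t.1 * t.2.1, t.2.2) 1
      + Finsupp.single (t.1, t.2.1 * t.2.2) 1 - Finsupp.single (t.1, t.2.1) 1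

/-- 2-cycles. -/
def Z2 : Submodule ℤ ((G × G) →₀ ℤ) := LinearMap.ker (d2 G)

/-- 2-boundaries. -/
def B2 : Submodule ℤ ((G × G) →₀ ℤ) := LinearMap.range (d3 G)

/-- The second homology group of `G` with trivial integral coefficients,
defined via the bar resolution as 2-cycles modulo 2-boundaries. -/
abbrev H2 := ↥(Z2 G) ⧸ (B2 G).comap (Z2 G).subtype

variable {G} {H : Type} [Group H]

/-- The map induced on bar 2-chains by a group homomorphism. -/
def C2 (f : G →* H) : ((G × G) →₀ ℤ) →ₗ[ℤ] ((H × H) →₀ ℤ) :=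
  Finsupp.lmapDomain ℤ ℤ (Prod.map f f)

def C1 (f : G →* H) : (G →₀ ℤ) →ₗ[ℤ] (H →₀ ℤ) :=
  Finsupp.lmapDomain ℤ ℤ f

def C3 (f : G →* H) : ((G × G × G) →₀ ℤ) →ₗ[ℤ] ((H × H × H) →₀ ℤ) :=
  Finsupp.lmapDomain ℤ ℤ (Prod.map f (Prod.map f f))

@[simp] theorem C2_single (f : G →* H) (p : G × G) (n : ℤ) :
    C2 f (Finsupp.single p n) = Finsupp.single (f p.1, f p.2) n := by
  simp [C2, Finsupp.mapDomain_single, Prod.map]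

@[simp] theorem C1_single (f : G →* H) (g : G) (n : ℤ) :
    C1 f (Finsupp.single g n) = Finsupp.single (f g) n := by
  simp [C1, Finsupp.mapDomain_single]

@[simp] theorem C3_single (f : G →* H) (t : G × G × G) (n : ℤ) :
    C3 f (Finsupp.single t n) = Finsupp.single (f t.1, f t.2.1, f t.2.2) n := by
  simp [C3, Finsupp.mapDomain_single, Prod.map]

theorem d2_comm (f : G →* H) : (d2 H).comp (C2 f) = (C1 f).comp (d2 G) := by
  refine Finsupp.lhom_ext fun p n => ?_
  simp only [LinearMap.comp_apply, C2_single, d2, Finsupp.linearCombination_single,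
    map_smul, map_sub, map_add, C1_single, map_mul]

theorem d3_comm (f : G →* H) : (d3 H).comp (C3 f) = (C2 f).comp (d3 G) := by
  refine Finsupp.lhom_ext fun t n => ?_
  simp only [LinearMap.comp_apply, C3_single, d3, Finsupp.linearCombination_single,
    map_smul, map_sub, map_add, C2_single, map_mul]

theorem C2_mem_Z2 (f : G →* H) : ∀ x ∈ Z2 G, C2 f x ∈ Z2 H := by
  intro x hx
  have := congrArg (fun φ => φ x) (d2_comm f)
  simp only [LinearMap.comp_apply] at this
  simp only [Z2, LinearMap.mem_ker] at hx ⊢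
  rw [this, hx, map_zero]

/-- The map induced by a group homomorphism on second homology. -/
def H2Map (f : G →* H) : H2 G →ₗ[ℤ] H2 H :=
  Submodule.mapQ _ _ ((C2 f).restrict (C2_mem_Z2 f)) (by
    rintro ⟨x, hxZ⟩ hx
    simp only [Submodule.mem_comap, Submodule.subtype_apply] at hx ⊢
    simp only [LinearMap.restrict_apply]
    obtain ⟨w, hw⟩ := hx
    have := congrArg (fun φ => φ w) (d3_comm f)
    simp only [LinearMap.comp_apply] at this
    exact ⟨C3 f w, by rw [this, hw]⟩)

end GpH2



open Matrix

/-- The symplectic group `Sp(2g, R)`: matrices `M` (of size `2g`) with `Mᵀ * J * M = J`,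
where `J` is the standard symplectic form (see `SymplecticGroup.mem_iff'`). -/
abbrev Sp (g : ℕ) (R : Type) [CommRing R] : Submonoid (Matrix (Fin g ⊕ Fin g) (Fin g ⊕ Fin g) R) :=
  Matrix.symplecticGroup (Fin g) R

namespace SpAux

variable {g : ℕ} {R S : Type} [CommRing R] [CommRing S]

theorem J_map (f : R →+* S) : (Matrix.J (Fin g) R).map f = Matrix.J (Fin g) S := by
  ext i j
  rcases i with i | i <;> rcases j with j | j <;>
    simp [Matrix.J, Matrix.fromBlocks, Matrix.one_apply, apply_ite f]

theorem map_mem (f : R →+* S) {A : Matrix (Fin g ⊕ Fin g) (Fin g ⊕ Fin g) R}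
    (hA : A ∈ Sp g R) : A.map f ∈ Sp g S := by
  rw [SymplecticGroup.mem_iff] at hA ⊢
  rw [← J_map f, ← Matrix.transpose_map, ← Matrix.map_mul, ← Matrix.map_mul, hA]

/-- The homomorphism `Sp(2g, R) → Sp(2g, S)` induced by a ring homomorphism `R → S`
(entrywise application). -/
def SpMap (f : R →+* S) (g : ℕ) : Sp g R →* Sp g S where
  toFun A := ⟨Matrix.map A.1 f, map_mem f A.2⟩
  map_one' := Subtype.ext <| by
    show ((1 : Matrix _ _ R)).map f = (1 : Matrix _ _ S)
    exact Matrix.map_one f (map_zero f) (map_one f)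
  map_mul' A B := Subtype.ext <| by
    show Matrix.map (A.1 * B.1) f = Matrix.map A.1 f * Matrix.map B.1 f
    exact Matrix.map_mul

end SpAux

namespace Hyp

open Matrix

variable {g : ℕ} {R : Type} [CommRing R]

theorem hyp_mem (A : Matrix.SpecialLinearGroup (Fin g) R) :
    Matrix.fromBlocks (A : Matrix (Fin g) (Fin g) R) 0 0 (((A : Matrix (Fin g) (Fin g) R)ᵀ)⁻¹)
      ∈ Sp g R := by
  have hdet : IsUnit (A : Matrix (Fin g) (Fin g) R).det := by
    rw [A.2]; exact isUnit_one
  have hdet' : IsUnit ((A : Matrix (Fin g) (Fin g) R)ᵀ).det := by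
    rw [Matrix.det_transpose, A.2]; exact isUnit_one
  have h1 : (A : Matrix (Fin g) (Fin g) R) * (((A : Matrix (Fin g) (Fin g) R)ᵀ)⁻¹)ᵀ = 1 := by
    rw [← Matrix.transpose_nonsing_inv, Matrix.transpose_transpose,
      Matrix.mul_nonsing_inv _ hdet]
  have h2 : ((A : Matrix (Fin g) (Fin g) R)ᵀ)⁻¹ * (A : Matrix (Fin g) (Fin g) R)ᵀ = 1 :=
    Matrix.nonsing_inv_mul _ hdet'
  rw [SymplecticGroup.mem_iff, Matrix.J, Matrix.fromBlocks_multiply,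
    Matrix.fromBlocks_transpose, Matrix.fromBlocks_multiply]
  simp [h1, h2]

/-- The hyperbolization homomorphism `SL(g, R) → Sp(2g, R)`, sending `A` to the
block-diagonal matrix `diag(A, (Aᵀ)⁻¹)`. -/
def hyp (g : ℕ) (R : Type) [CommRing R] :
    Matrix.SpecialLinearGroup (Fin g) R →* ↥(Sp g R) where
  toFun A := ⟨Matrix.fromBlocks (A : Matrix (Fin g) (Fin g) R) 0 0
      (((A : Matrix (Fin g) (Fin g) R)ᵀ)⁻¹), hyp_mem A⟩
  map_one' := Subtype.ext <| by
    show Matrix.fromBlocks _ _ _ _ = (1 : Matrix _ _ R)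
    simp [Matrix.transpose_one, inv_one, Matrix.fromBlocks_one]
  map_mul' A B := Subtype.ext <| by
    show Matrix.fromBlocks _ _ _ _ = Matrix.fromBlocks _ _ _ _ * Matrix.fromBlocks _ _ _ _
    rw [Matrix.fromBlocks_multiply]
    simp [Matrix.transpose_mul, Matrix.mul_inv_rev]

end Hyp

/-- Elements `y i j` (`i ≠ j`) of a group satisfying the Steinberg relations of
exponent four. -/
structure SteinbergFamily {ι E : Type*} [Group E] (y : ι → ι → E) : Prop where
  third : ∀ i j : ι, ∃ k, k ≠ i ∧ k ≠ j
  pow_four : ∀ i j, i ≠ j → y i j ^ 4 = 1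
  comm : ∀ i j k l, i ≠ j → k ≠ l → j ≠ k → i ≠ l → Commute (y i j) (y k l)
  bracket : ∀ i j k, i ≠ j → j ≠ k → i ≠ k → y i j * y j k = y i k * y j k * y i j

/-- The Weyl element `y i j * (y j i)⁻¹ * y i j`. -/
def weyl {ι E : Type*} [Group E] (y : ι → ι → E) (i j : ι) : E :=
  y i j * (y j i)⁻¹ * y i j

theorem semiconj_weyl_of_bracket {E : Type*} [Group E] {a b p q : E} (h₁ : a * q = p * q * a)
    (h₂ : b * p = q * p * b) (hpq : Commute p q) (hap : Commute a p) (hbq : Commute b q) :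
    SemiconjBy (a * b⁻¹ * a) q p ∧ SemiconjBy (a * b⁻¹ * a) p q⁻¹ := by
  have e₁ : SemiconjBy a q (p * q) := h₁
  have e₂ : SemiconjBy b p (q * p) := h₂
  have e₃ : SemiconjBy b⁻¹ (q * p) p := SemiconjBy.inv_symm_left_iff.2 e₂
  have e₄ : SemiconjBy b⁻¹ p (q⁻¹ * p) := by
    have := (SemiconjBy.inv_right (Commute.inv_left hbq : SemiconjBy b⁻¹ q q)).mul_right e₃
    simpa using this
  refine ⟨?_, ?_⟩
  · rw [hpq.eq] at e₁
    exact (SemiconjBy.mul_left (SemiconjBy.mul_left hap e₃) e₁)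
  · refine SemiconjBy.mul_left (SemiconjBy.mul_left ?_ e₄) hap
    have := e₁.inv_right.mul_right hap
    rwa [_root_.mul_inv_rev, mul_assoc, inv_mul_cancel, mul_one] at this

namespace SteinbergFamily

variable {ι E : Type*} [Group E] {y : ι → ι → E} (h : SteinbergFamily y)
include h

theorem semiconj_row {i j k : ι} (hij : i ≠ j) (hik : k ≠ i) (hjk : k ≠ j) :
    SemiconjBy (weyl y i j) (y j k) (y i k) ∧ SemiconjBy (weyl y i j) (y i k) (y j k)⁻¹ :=
  semiconj_weyl_of_bracket (h.bracket i j k hij hjk.symm hik.symm)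
    (h.bracket j i k hij.symm hik.symm hjk.symm)
    (h.comm _ _ _ _ hik.symm hjk.symm hjk hik.symm)
    (h.comm _ _ _ _ hij hik.symm hij.symm hik.symm)
    (h.comm _ _ _ _ hij.symm hjk.symm hij hjk.symm)

theorem semiconj_col {i j k : ι} (hij : i ≠ j) (hik : k ≠ i) (hjk : k ≠ j) :
    SemiconjBy (weyl y i j) (y k j) (y k i) ∧ SemiconjBy (weyl y i j) (y k i) (y k j)⁻¹ := by
  have e₁ : SemiconjBy (y i j) (y k i) ((y k j)⁻¹ * y k i) := by
    have := h.bracket k i j hik hij hjk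
    rw [SemiconjBy, mul_assoc, this]; group
  have e₂ : SemiconjBy (y j i) (y k j) ((y k i)⁻¹ * y k j) := by
    have := h.bracket k j i hjk hij.symm hik
    rw [SemiconjBy, mul_assoc, this]; group
  have hc : Commute (y k j) (y k i) := h.comm _ _ _ _ hjk hik hjk.symm hik
  have h₁ : Commute (y i j) (y k j) := h.comm _ _ _ _ hij hjk hjk.symm hij
  have h₂ : Commute (y j i) (y k i) := h.comm _ _ _ _ hij.symm hik hik.symm hij.symm
  have := semiconj_weyl_of_bracket (a := y i j) (b := y j i) (q := y k i) (p := (y k j)⁻¹) e₁.eq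
    (by
      have := e₂.inv_right
      rw [_root_.mul_inv_rev, inv_inv, hc.inv_left.eq] at this
      exact this.eq)
    hc.inv_left h₁.inv_right h₂
  have e := this.2.inv_right
  rw [inv_inv, inv_inv] at e
  exact ⟨e, this.1⟩

theorem semiconj_self {i j : ι} (hij : i ≠ j) :
    SemiconjBy (weyl y i j) (y i j) (y j i)⁻¹ ∧ SemiconjBy (weyl y i j) (y j i) (y i j)⁻¹ := by
  obtain ⟨k, hki, hkj⟩ := h.third i j
  have r := h.semiconj_row hij hki hkj
  have c := h.semiconj_col hij hki hkj
  have b₁ := h.bracket i k j hki.symm hkj hij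
  have b₂ := h.bracket j k i hkj.symm hki hij.symm
  constructor
  · have e : y i j = y i k * y k j * (y i k)⁻¹ * (y k j)⁻¹ := by rw [b₁]; group
    have := ((r.2.mul_right c.1).mul_right r.2.inv_right).mul_right c.1.inv_right
    rw [← e] at this
    rw [inv_inv] at this
    suffices e : (y j i)⁻¹ = (y j k)⁻¹ * y k i * y j k * (y k i)⁻¹ by rwa [e]
    rw [mul_assoc _ (y k i) _]
    have : y k i * y j k = (y j i)⁻¹ * y j k * y k i := by rw [mul_assoc, b₂]; group
    rw [this]
    have hc : Commute (y j k) (y j i) := h.comm _ _ _ _ hkj.symm hij.symm hkj hij.symm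
    calc (y j i)⁻¹ = (y j k)⁻¹ * (y j k * (y j i)⁻¹) := by group
      _ = (y j k)⁻¹ * ((y j i)⁻¹ * y j k) := by rw [hc.inv_right.eq]
      _ = _ := by group
  · have e : y j i = y j k * y k i * (y j k)⁻¹ * (y k i)⁻¹ := by rw [b₂]; group
    have := ((r.1.mul_right c.2).mul_right r.1.inv_right).mul_right c.2.inv_right
    rw [← e] at this
    suffices e : (y i j)⁻¹ = y i k * (y k j)⁻¹ * (y i k)⁻¹ * (y k j)⁻¹⁻¹ by rwa [e]
    have : y k j * y i k = (y i j)⁻¹ * y i k * y k j := by rw [mul_assoc, b₁]; group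
    have hc : Commute (y i j) (y k j) := h.comm _ _ _ _ hij hkj hkj.symm hij
    have h' : y i k * (y k j)⁻¹ * (y i k)⁻¹ = (y k j)⁻¹ * (y i j)⁻¹ := by
      rw [mul_inv_eq_iff_eq_mul, mul_assoc, eq_inv_mul_iff_mul_eq, ← mul_assoc, this]; group
    rw [h', inv_inv, mul_assoc, hc.inv_left.eq]; group

theorem weyl_swap {i j : ι} (hij : i ≠ j) : weyl y j i = (weyl y i j)⁻¹ := by
  have s := h.semiconj_self hij
  have := (s.1.mul_right s.2.inv_right).mul_right s.1
  change SemiconjBy (weyl y i j) (weyl y i j) _ at this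
  have e : weyl y i j = (y j i)⁻¹ * (y i j)⁻¹⁻¹ * (y j i)⁻¹ := mul_right_cancel this.eq
  rw [e, weyl]; group

theorem weyl_weyl {i j k : ι} (hij : i ≠ j) (hik : k ≠ i) (hjk : k ≠ j) :
    SemiconjBy (weyl y i j) (weyl y j k) (weyl y i k) ∧
      SemiconjBy (weyl y i j) (weyl y i k) (weyl y j k)⁻¹ := by
  have r := h.semiconj_row hij hik hjk
  have c := h.semiconj_col hij hik hjk
  refine ⟨(r.1.mul_right c.1.inv_right).mul_right r.1, ?_⟩
  have := (r.2.mul_right c.2.inv_right).mul_right r.2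
  suffices e : (weyl y j k)⁻¹ = (y j k)⁻¹ * (y k j)⁻¹⁻¹ * (y j k)⁻¹ by rwa [e]
  simp [weyl, mul_assoc]

theorem commute_weyl {i j k l : ι} (hij : i ≠ j) (hkl : k ≠ l) (hki : k ≠ i) (hkj : k ≠ j)
    (hli : l ≠ i) (hlj : l ≠ j) : Commute (weyl y i j) (y k l) := by
  have h₁ := h.comm i j k l hij hkl hkj.symm hli.symm
  have h₂ := h.comm j i k l hij.symm hkl hki.symm hlj.symm
  exact (h₁.mul_left h₂.inv_left).mul_left h₁

theorem eq_mul_weyl_mul {i j : ι} (hij : i ≠ j) : y i j = y j i * weyl y i j * y j i := by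
  rw [show weyl y i j = (weyl y j i)⁻¹ from h.weyl_swap hij.symm, weyl]; group

theorem inv_eq_pow {i j : ι} (hij : i ≠ j) : (y i j)⁻¹ = y i j ^ 3 :=
  inv_eq_of_mul_eq_one_left (by rw [← pow_succ, h.pow_four i j hij])

/-- The rank-one relation for a product of an elementary element with the square of its
opposite. -/
theorem mul_sq {i j : ι} (hij : i ≠ j) :
    y i j * y j i ^ 2 = y j i ^ 2 * weyl y i j ^ 2 * (y i j)⁻¹ := by
  have s := h.semiconj_self hij
  have e : weyl y i j * y i j * (y j i)⁻¹ * y i j = weyl y i j ^ 2 := by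
    rw [sq]; simp only [weyl, mul_assoc]
  rw [← e]
  have e₁ := h.inv_eq_pow hij.symm
  have e₂ : (y j i)⁻¹ = y j i * y j i ^ 2 := by rw [e₁]; group
  have e₃ := s.1.eq
  have e₄ : weyl y i j = y i j * (y j i)⁻¹ * y i j := rfl
  have e₅ : (weyl y i j) = (y j i)⁻¹ * y i j * (y j i)⁻¹ := by
    have := h.weyl_swap hij.symm
    rw [this, weyl]; group
  rw [e₃, e₅]
  calc y i j * y j i ^ 2 = y j i ^ 2 * (y j i)⁻¹ * (y j i)⁻¹ * y i j * (y j i ^ 2) := by group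
    _ = y j i ^ 2 * (y j i)⁻¹ * (y j i)⁻¹ * y i j * (y j i)⁻¹ * (y j i ^ 3) := by
        group
    _ = y j i ^ 2 * (y j i)⁻¹ * (y j i)⁻¹ * y i j * (y j i)⁻¹ * (y j i)⁻¹ := by
        rw [← e₁]
    _ = _ := by group

theorem sq_semiconj_row {i j k : ι} (hij : i ≠ j) (hik : k ≠ i) (hjk : k ≠ j) :
    SemiconjBy (weyl y i j ^ 2) (y j k) (y j k)⁻¹ ∧
      SemiconjBy (weyl y i j ^ 2) (y i k) (y i k)⁻¹ := by
  have r := h.semiconj_row hij hik hjk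
  rw [sq]
  exact ⟨r.2.mul_left r.1, r.1.inv_right.mul_left r.2⟩

theorem sq_semiconj_col {i j k : ι} (hij : i ≠ j) (hik : k ≠ i) (hjk : k ≠ j) :
    SemiconjBy (weyl y i j ^ 2) (y k j) (y k j)⁻¹ ∧
      SemiconjBy (weyl y i j ^ 2) (y k i) (y k i)⁻¹ := by
  have r := h.semiconj_col hij hik hjk
  rw [sq]
  exact ⟨r.2.mul_left r.1, r.1.inv_right.mul_left r.2⟩

theorem weyl_sq_mul {i j k : ι} (hij : i ≠ j) (hik : k ≠ i) (hjk : k ≠ j) :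
    weyl y i k ^ 2 = weyl y i j ^ 2 * weyl y j k ^ 2 := by
  have s₁ : SemiconjBy (weyl y j k) (weyl y i k ^ 2) (weyl y i j ^ 2) := by
    have := ((h.weyl_weyl hjk.symm hij hik.symm).1).inv_right.pow_right 2
    rwa [h.weyl_swap hik.symm, h.weyl_swap hij, inv_inv, inv_inv] at this
  have s₂ : SemiconjBy (weyl y i k ^ 2) (weyl y j k) (weyl y j k)⁻¹ := by
    have r := (h.sq_semiconj_row hik.symm hij.symm hjk.symm).1
    have c := (h.sq_semiconj_col hik.symm hij.symm hjk.symm).1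
    have := (c.mul_right r.inv_right).mul_right c
    suffices e : (weyl y j k)⁻¹ = (y j k)⁻¹ * (y k j)⁻¹⁻¹ * (y j k)⁻¹ by rwa [e]
    simp [weyl, mul_assoc]
  calc weyl y i k ^ 2 = weyl y j k * ((weyl y j k)⁻¹ * weyl y i k ^ 2) := by group
    _ = weyl y i j ^ 2 * weyl y j k ^ 2 := by
      rw [← s₂.eq, ← mul_assoc, s₁.eq, mul_assoc, sq (weyl y j k)]

end SteinbergFamily

section ClosureInduction

variable {E : Type*} [Group E]

theorem closure_induction_of_pow_four {s : Set E} (hs : ∀ x ∈ s, x ^ 4 = 1) {p : E → Prop}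
    (one : p 1) (mul : ∀ x ∈ s, ∀ g, p g → p (x * g)) : ∀ g ∈ Subgroup.closure s, p g := by
  intro g hg
  induction hg using Subgroup.closure_induction_left with
  | one => exact one
  | mul_left x hx g _ ih => exact mul x hx g ih
  | inv_mul_cancel x hx g _ ih =>
    have e : x⁻¹ * g = x * (x * (x * g)) := by
      rw [inv_mul_eq_iff_eq_mul]
      have := hs x hx
      rw [pow_succ, pow_succ, sq] at this
      simp only [← mul_assoc, this, one_mul]
    rw [e]
    exact mul x hx _ (mul x hx _ (mul x hx _ ih))

/-- An element conjugating generators of a subgroup into a subgroup conjugates the whole of it. -/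
theorem exists_mem_mul_eq_mul {s : Set E} {L : Subgroup E} {a : E}
    (hs : ∀ x ∈ s, ∃ x' ∈ L, a * x = x' * a) :
    ∀ u ∈ Subgroup.closure s, ∃ u' ∈ L, a * u = u' * a := by
  intro u hu
  induction hu using Subgroup.closure_induction with
  | mem x hx => exact hs x hx
  | one => exact ⟨1, one_mem _, by simp⟩
  | mul x z _ _ hx hz =>
    obtain ⟨x', hx', ex⟩ := hx
    obtain ⟨z', hz', ez⟩ := hz
    exact ⟨x' * z', mul_mem hx' hz', by rw [← mul_assoc, ex, mul_assoc, ez, mul_assoc]⟩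
  | inv x _ hx =>
    obtain ⟨x', hx', ex⟩ := hx
    exact ⟨x'⁻¹, inv_mem hx', SemiconjBy.inv_right (show SemiconjBy a x x' from ex)⟩

theorem commute_of_mem_closure {s : Set E} {a : E} (hs : ∀ x ∈ s, Commute a x) :
    ∀ u ∈ Subgroup.closure s, Commute a u := by
  intro u hu
  induction hu using Subgroup.closure_induction with
  | mem x hx => exact hs x hx
  | one => exact Commute.one_right a
  | mul x z _ _ hx hz => exact hx.mul_right hz
  | inv x _ hx => exact hx.inv_right

/-- Splitting off one generator of a subgroup generated by commuting elements. -/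
theorem exists_pow_mul_of_mem_closure {ι : Type*} {z : ι → E} {T : Set ι} {k : ι}
    (h4 : ∀ j ∈ T, z j ^ 4 = 1) (hk : ∀ j ∈ T, Commute (z k) (z j)) :
    ∀ u ∈ Subgroup.closure (z '' T), ∃ r : ℕ, ∃ u' ∈ Subgroup.closure (z '' (T \ {k})),
      u = z k ^ r * u' := by
  refine closure_induction_of_pow_four ?_ ⟨0, 1, one_mem _, by simp⟩ ?_
  · rintro _ ⟨j, hj, rfl⟩
    exact h4 j hj
  · rintro _ ⟨j, hj, rfl⟩ g ⟨r, u', hu', rfl⟩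
    by_cases e : j = k
    · subst e
      exact ⟨r + 1, u', hu', by rw [pow_succ', mul_assoc]⟩
    · exact ⟨r, z j * u', mul_mem (Subgroup.subset_closure ⟨j, ⟨hj, e⟩, rfl⟩) hu', by
        rw [← mul_assoc, ← ((hk j hj).pow_left r).eq, mul_assoc]⟩

theorem smul_mk_of_semiconj {K : Subgroup E} {r a p : E} (hr : SemiconjBy r p a) (hp : p ∈ K) :
    a • (r : E ⧸ K) = (r : E ⧸ K) := by
  rw [MulAction.Quotient.smul_coe, smul_eq_mul, ← hr.eq, QuotientGroup.mk_mul_of_mem _ hp]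

end ClosureInduction

namespace SteinbergFamily

variable {ι E : Type*} [DecidableEq ι] [Group E] {y : ι → ι → E}

/-- The subgroup generated by `y j i` for `j ∈ T`. -/
abbrev colGroup (y : ι → ι → E) (T : Set ι) (i : ι) : Subgroup E :=
  Subgroup.closure ((fun j => y j i) '' T)

/-- The subgroup generated by `y i j` for `j ∈ T`. -/
abbrev rowGroup (y : ι → ι → E) (T : Set ι) (i : ι) : Subgroup E :=
  Subgroup.closure ((fun j => y i j) '' T)

/-- A subgroup containing the elements `y i j` with `j ≠ o` and the squares of the Weyl elements
at `o` (with indices in `S`). -/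
structure ContainsParabolic (y : ι → ι → E) (S : Set ι) (o : ι) (K : Subgroup E) : Prop where
  base : o ∈ S
  elem : ∀ i ∈ S, ∀ j ∈ S, i ≠ j → j ≠ o → y i j ∈ K
  sq : ∀ k ∈ S, k ≠ o → weyl y o k ^ 2 ∈ K

/-- The base coset moved to the index `i`. -/
def coset (y : ι → ι → E) (K : Subgroup E) (o i : ι) : E ⧸ K :=
  if i = o then QuotientGroup.mk 1 else QuotientGroup.mk (weyl y i o)

variable (h : SteinbergFamily y) {S : Set ι} {o : ι} {K : Subgroup E}
  (hK : ContainsParabolic y S o K)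
include h hK

theorem smul_coset_of_ne {i k l : ι} (hi : i ∈ S) (hk : k ∈ S) (hl : l ∈ S) (hkl : k ≠ l)
    (hli : l ≠ i) : y k l • coset y K o i = coset y K o i := by
  unfold coset
  split_ifs with hio
  · subst hio
    exact smul_mk_of_semiconj (SemiconjBy.one_left _) (hK.elem k hk l hl hkl hli)
  · by_cases hko : k = o
    · subst hko
      have e' : SemiconjBy (weyl y i k) (y i l)⁻¹ (y k l) := by
        simpa only [inv_inv] using (h.semiconj_row hio hli hkl.symm).2.inv_right
      exact smul_mk_of_semiconj e' (inv_mem (hK.elem i hi l hl hli.symm hkl.symm))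
    · by_cases hlo : l = o
      · subst hlo
        by_cases hki : k = i
        · subst hki
          have e := (h.semiconj_self hkl).2.inv_right
          rw [inv_inv] at e
          exact smul_mk_of_semiconj e (inv_mem (hK.elem l hl k hk hkl.symm hkl))
        · have e := (h.semiconj_col hio hki hkl).2.inv_right
          rw [inv_inv] at e
          exact smul_mk_of_semiconj e (inv_mem (hK.elem k hk i hi hki hio))
      · by_cases hki : k = i
        · subst hki
          exact smul_mk_of_semiconj (h.semiconj_row hio hli hlo).1
            (hK.elem o hK.base l hl (Ne.symm hlo) hlo)
        · exact smul_mk_of_semiconj (h.commute_weyl hio hkl hki hko hli hlo)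
            (hK.elem k hk l hl hkl hlo)

theorem sq_smul_coset {i l : ι} (hi : i ∈ S) (hl : l ∈ S) (hli : l ≠ i) :
    weyl y i l ^ 2 • coset y K o i = coset y K o i := by
  unfold coset
  split_ifs with hio
  · subst hio
    exact smul_mk_of_semiconj (SemiconjBy.one_left _) (hK.sq l hl hli)
  · by_cases hlo : l = o
    · subst hlo
      refine smul_mk_of_semiconj (Commute.self_pow _ 2) ?_
      rw [h.weyl_swap hli, inv_pow]
      exact inv_mem (hK.sq i hi hio)
    · exact smul_mk_of_semiconj ((h.weyl_weyl hio hli hlo).1.pow_right 2) (hK.sq l hl hlo)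

theorem weyl_smul_coset {k l : ι} (hk : k ∈ S) (hl : l ∈ S) (hkl : k ≠ l) :
    weyl y k l • coset y K o l = coset y K o k := by
  unfold coset
  by_cases hlo : l = o
  · subst hlo
    rw [if_pos rfl, if_neg hkl, MulAction.Quotient.smul_coe, smul_eq_mul, mul_one]
  · rw [if_neg hlo, MulAction.Quotient.smul_coe, smul_eq_mul]
    by_cases hko : k = o
    · subst hko
      rw [if_pos rfl, h.weyl_swap hkl, mul_inv_cancel]
    · rw [if_neg hko, (h.weyl_weyl hkl (Ne.symm hko) (Ne.symm hlo)).1.eq,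
        QuotientGroup.mk_mul_of_mem]
      have a := hK.elem k hk l hl hkl hlo
      have b := hK.elem l hl k hk hkl.symm hko
      exact mul_mem (mul_mem a (inv_mem b)) a

theorem weyl_inv_smul_coset {k l : ι} (hk : k ∈ S) (hl : l ∈ S) (hkl : k ≠ l) :
    (weyl y k l)⁻¹ • coset y K o l = coset y K o k := by
  have e : (weyl y k l)⁻¹ = weyl y k l * weyl y l k ^ 2 := by
    rw [h.weyl_swap hkl]; group
  rw [e, mul_smul, h.sq_smul_coset hK hl hk hkl, h.weyl_smul_coset hK hk hl hkl]

theorem smul_col_smul_coset {i l : ι} (hi : i ∈ S) (hl : l ∈ S) (hli : l ≠ i) :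
    ∀ u ∈ colGroup y ((S \ {i}) \ {l}) i, y i l • u • coset y K o i = u • coset y K o i := by
  have gen : ∀ j ∈ S, j ≠ i → j ≠ l → ∀ u ∈ colGroup y ((S \ {i}) \ {l}) i,
      y j l • u • coset y K o i = u • coset y K o i := by
    intro j hj hji hjl u hu
    have : Commute (y j l) u := by
      refine commute_of_mem_closure ?_ u hu
      rintro _ ⟨m, ⟨⟨hm, hmi⟩, hml⟩, rfl⟩
      exact h.comm _ _ _ _ hjl hmi (Ne.symm hml) hji
    rw [smul_smul, this.eq, mul_smul, h.smul_coset_of_ne hK hi hj hl hjl hli]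
  intro u hu
  suffices u ∈ colGroup y ((S \ {i}) \ {l}) i ∧
      y i l • u • coset y K o i = u • coset y K o i from this.2
  refine closure_induction_of_pow_four (p := fun u => u ∈ colGroup y ((S \ {i}) \ {l}) i ∧
      y i l • u • coset y K o i = u • coset y K o i) ?_ ?_ ?_ u hu
  · rintro _ ⟨m, ⟨⟨hm, hmi⟩, hml⟩, rfl⟩
    exact h.pow_four _ _ hmi
  · exact ⟨one_mem _, by rw [one_smul, h.smul_coset_of_ne hK hi hi hl hli.symm hli]⟩
  · rintro _ ⟨j, hj, rfl⟩ u ⟨hu, ih⟩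
    have hju : y j i * u ∈ colGroup y ((S \ {i}) \ {l}) i :=
      mul_mem (Subgroup.subset_closure ⟨j, hj, rfl⟩) hu
    obtain ⟨⟨hjS, hji⟩, hjl⟩ := hj
    refine ⟨hju, ?_⟩
    have e : y i l * y j i = (y j l)⁻¹ * (y j i * y i l) := by
      rw [h.bracket j i l hji hli.symm hjl]; group
    dsimp only
    rw [smul_smul, ← mul_assoc, e, mul_smul, mul_smul, mul_smul, ih, inv_smul_eq_iff,
      ← mul_smul (y j i), gen j hjS hji hjl _ hju]

theorem smul_col_of_ne {i k l : ι} (hi : i ∈ S) (hk : k ∈ S) (hl : l ∈ S) (hkl : k ≠ l)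
    (hki : k ≠ i) (u : E) (hu : u ∈ colGroup y (S \ {i}) i) :
    ∃ u' ∈ colGroup y (S \ {i}) i, y k l • u • coset y K o i = u' • coset y K o i := by
  have hki' : y k i ∈ colGroup y (S \ {i}) i := Subgroup.subset_closure ⟨k, ⟨hk, hki⟩, rfl⟩
  by_cases hli : l = i
  · subst hli
    exact ⟨y k l * u, mul_mem hki' hu, by rw [mul_smul]⟩
  · obtain ⟨u', hu', e⟩ : ∃ u' ∈ colGroup y (S \ {i}) i, y k l * u = u' * y k l := by
      refine exists_mem_mul_eq_mul ?_ u hu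
      rintro _ ⟨j, ⟨hj, hji⟩, rfl⟩
      have hj' : y j i ∈ colGroup y (S \ {i}) i := Subgroup.subset_closure ⟨j, ⟨hj, hji⟩, rfl⟩
      by_cases hjl : j = l
      · subst hjl
        exact ⟨_, mul_mem hki' hj', h.bracket k j i hkl hji hki⟩
      · exact ⟨_, hj', h.comm _ _ _ _ hkl hji (Ne.symm hjl) hki⟩
    refine ⟨u', hu', ?_⟩
    rw [smul_smul, e, mul_smul, h.smul_coset_of_ne hK hi hk hl hkl hli]

omit [DecidableEq ι] hK in
theorem col_split {i l : ι} (u : E) (hu : u ∈ colGroup y (S \ {i}) i)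
    (hli : l ≠ i) : ∃ r : ℕ, ∃ u' ∈ colGroup y ((S \ {i}) \ {l}) i, u = y l i ^ r * u' :=
  exists_pow_mul_of_mem_closure (z := fun j => y j i) (fun _ hj => h.pow_four _ _ hj.2)
    (fun _ hj => h.comm _ _ _ _ hli hj.2 (Ne.symm hj.2) hli) u hu

omit [DecidableEq ι] h hK in
theorem col_mono {i l : ι} : colGroup y ((S \ {i}) \ {l}) i ≤ colGroup y (S \ {i}) i :=
  Subgroup.closure_mono (Set.image_mono Set.sdiff_subset)

theorem smul_sq_mul_col {i l : ι} (hi : i ∈ S) (hl : l ∈ S) (hli : l ≠ i) (u : E)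
    (hu : u ∈ colGroup y ((S \ {i}) \ {l}) i) :
    ∃ u' ∈ colGroup y (S \ {i}) i,
      y i l • (y l i ^ 2 * u) • coset y K o i = u' • coset y K o i := by
  obtain ⟨u', hu', e⟩ : ∃ u' ∈ colGroup y ((S \ {i}) \ {l}) i,
      weyl y i l ^ 2 * u = u' * weyl y i l ^ 2 := by
    refine exists_mem_mul_eq_mul ?_ u hu
    rintro _ ⟨j, hj, rfl⟩
    exact ⟨_, inv_mem (Subgroup.subset_closure ⟨j, hj, rfl⟩),
      (h.sq_semiconj_col hli.symm hj.1.2 hj.2).2⟩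
  have hyl : y l i ∈ colGroup y (S \ {i}) i := Subgroup.subset_closure ⟨l, ⟨hl, hli⟩, rfl⟩
  refine ⟨y l i ^ 2 * u', mul_mem (pow_mem hyl 2) (col_mono hu'), ?_⟩
  have f := h.smul_col_smul_coset hK hi hl hli u hu
  rw [smul_smul, ← mul_assoc, h.mul_sq hli.symm, mul_smul, mul_smul, inv_smul_eq_iff.2 f.symm,
    mul_smul, smul_smul (weyl y i l ^ 2), e, mul_smul u', h.sq_smul_coset hK hi hl hli, mul_smul]

theorem swap_col {k l : ι} (hk : k ∈ S) (hl : l ∈ S) (hkl : k ≠ l) (u : E)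
    (hu : u ∈ colGroup y ((S \ {l}) \ {k}) l) :
    (∃ u' ∈ colGroup y (S \ {k}) k, (y k l * u) • coset y K o l = u' • coset y K o k) ∧
      ∃ u' ∈ colGroup y (S \ {k}) k, ((y k l)⁻¹ * u) • coset y K o l = u' • coset y K o k := by
  have f := h.smul_col_smul_coset hK hl hk hkl u hu
  have hlk : y l k ∈ colGroup y (S \ {k}) k := Subgroup.subset_closure ⟨l, ⟨hl, hkl.symm⟩, rfl⟩
  constructor
  · obtain ⟨u', hu', e⟩ : ∃ u' ∈ colGroup y (S \ {k}) k,
        weyl y k l * u = u' * weyl y k l := by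
      refine exists_mem_mul_eq_mul ?_ u hu
      rintro _ ⟨j, hj, rfl⟩
      exact ⟨_, Subgroup.subset_closure ⟨j, ⟨hj.1.1, hj.2⟩, rfl⟩,
        (h.semiconj_col hkl hj.2 hj.1.2).1⟩
    refine ⟨y l k * u', mul_mem hlk hu', ?_⟩
    rw [h.eq_mul_weyl_mul hkl, mul_smul, mul_smul, f, mul_smul (y l k), smul_smul _ u, e,
      mul_smul, h.weyl_smul_coset hK hk hl hkl, mul_smul]
  · obtain ⟨u', hu', e⟩ : ∃ u' ∈ colGroup y (S \ {k}) k,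
        (weyl y k l)⁻¹ * u = u' * (weyl y k l)⁻¹ := by
      rw [← h.weyl_swap hkl]
      refine exists_mem_mul_eq_mul ?_ u hu
      rintro _ ⟨j, hj, rfl⟩
      exact ⟨_, inv_mem (Subgroup.subset_closure ⟨j, ⟨hj.1.1, hj.2⟩, rfl⟩),
        (h.semiconj_col hkl.symm hj.1.2 hj.2).2⟩
    refine ⟨(y l k)⁻¹ * u', mul_mem (inv_mem hlk) hu', ?_⟩
    have e' : (y k l)⁻¹ = (y l k)⁻¹ * ((weyl y k l)⁻¹ * (y l k)⁻¹) := by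
      conv_lhs => rw [h.eq_mul_weyl_mul hkl]
      group
    rw [e', mul_smul, mul_smul, mul_smul, inv_smul_eq_iff.2 f.symm, smul_smul _ u, e,
      mul_smul, h.weyl_inv_smul_coset hK hk hl hkl, mul_smul]

end SteinbergFamily

section Coordinates

variable {ι R : Type*} [DecidableEq ι] [Fintype ι] [CommRing R]

theorem transvection_smul_apply {i j : ι} (hij : i ≠ j) (b : R) (v : ι → R) (k : ι) :
    (Matrix.SpecialLinearGroup.transvection hij b • v) k = v k + if k = i then b * v j else 0 := by
  change (((1 : Matrix ι ι R) + Matrix.single i j b) *ᵥ v) k = _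
  rw [Matrix.add_mulVec, Matrix.one_mulVec, Matrix.single_mulVec_eq, Pi.add_apply]
  congr 1
  simp [Pi.single_apply]

theorem smul_single_apply (A : Matrix.SpecialLinearGroup ι R) (i k : ι) :
    (A • (Pi.single i 1 : ι → R)) k = A.1 k i := by
  change (A.1 *ᵥ Pi.single i 1) k = _
  rw [Matrix.mulVec_single_one, Matrix.col_apply]

end Coordinates

namespace SteinbergFamily

variable {ι E : Type*} [DecidableEq ι] [Fintype ι] [Group E] {y : ι → ι → E}

/-- The homomorphism `π` sends `y i j` to the elementary matrix at `(i, j)`. -/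
def Elementary (y : ι → ι → E) (π : E →* Matrix.SpecialLinearGroup ι (ZMod 4)) : Prop :=
  ∀ i j (hij : i ≠ j), π (y i j) = Matrix.SpecialLinearGroup.transvection hij 1

variable (h : SteinbergFamily y) {π : E →* Matrix.SpecialLinearGroup ι (ZMod 4)}
  (hπ : Elementary y π)

section
include hπ

theorem smul_apply {i j : ι} (hij : i ≠ j) (v : ι → ZMod 4) (k : ι) :
    (π (y i j) • v) k = v k + if k = i then v j else 0 := by
  rw [hπ i j hij, transvection_smul_apply, one_mul]

theorem inv_smul_apply {i j : ι} (hij : i ≠ j) (v : ι → ZMod 4) (k : ι) :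
    (π (y i j)⁻¹ • v) k = v k - if k = i then v j else 0 := by
  rw [map_inv, hπ i j hij, Matrix.SpecialLinearGroup.transvection_inv, transvection_smul_apply]
  split_ifs <;> ring

theorem weyl_smul_apply {i j : ι} (hij : i ≠ j) (v : ι → ZMod 4) (k : ι) :
    (π (weyl y i j) • v) k = if k = i then v j else if k = j then - v i else v k := by
  rw [weyl, map_mul, map_mul, mul_smul, mul_smul]
  simp only [smul_apply hπ hij, inv_smul_apply hπ hij.symm]
  by_cases hki : k = i
  · subst hki; simp [hij, hij.symm]
  · by_cases hkj : k = j
    · subst hkj; simp [hki]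
    · simp [hki, hkj]

theorem weyl_sq_smul_apply {i j : ι} (hij : i ≠ j) (v : ι → ZMod 4) (k : ι) :
    (π (weyl y i j ^ 2) • v) k = if k = i ∨ k = j then - v k else v k := by
  rw [sq, map_mul, mul_smul]
  simp only [weyl_smul_apply hπ hij]
  by_cases hki : k = i
  · subst hki; simp [hij.symm]
  · by_cases hkj : k = j
    · subst hkj; simp [hki]
    · simp [hki, hkj]

theorem pow_smul_apply {i j : ι} (hij : i ≠ j) (r : ℕ) (v : ι → ZMod 4) (k : ι) :
    (π (y i j ^ r) • v) k = v k + if k = i then r * v j else 0 := by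
  induction r generalizing v with
  | zero => simp
  | succ r ih =>
    rw [pow_succ, map_mul, mul_smul, ih, smul_apply hπ hij, smul_apply hπ hij, if_neg hij.symm]
    split_ifs <;> push_cast <;> ring

include h

theorem col_coord {i : ι} {T : Set ι} (hT : i ∉ T) (u : E) (hu : u ∈ colGroup y T i) :
    (π u • (Pi.single i 1 : ι → ZMod 4)) i = 1 ∧
      ∀ l, l ∉ T → l ≠ i → (π u • (Pi.single i 1 : ι → ZMod 4)) l = 0 := by
  have ne : ∀ j ∈ T, j ≠ i := fun j hj e => hT (e ▸ hj)
  refine closure_induction_of_pow_four (p := fun u => (π u • (Pi.single i 1 : ι → ZMod 4)) i = 1 ∧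
      ∀ l, l ∉ T → l ≠ i → (π u • (Pi.single i 1 : ι → ZMod 4)) l = 0) ?_ ?_ ?_ u hu
  · rintro _ ⟨j, hj, rfl⟩
    exact h.pow_four _ _ (ne j hj)
  · simp +contextual
  · rintro _ ⟨j, hj, rfl⟩ u ⟨h₁, h₂⟩
    simp only [map_mul, mul_smul, smul_apply hπ (ne j hj)]
    refine ⟨by simp [h₁, (ne j hj).symm], fun l hl hli => ?_⟩
    rw [if_neg (show ¬ l = j by rintro rfl; exact hl hj), h₂ l hl hli, add_zero]

theorem col_pow_coord {i l : ι} {T : Set ι} (hT : i ∉ T) (hl : l ∉ T) (hli : l ≠ i) (r : ℕ)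
    (u : E) (hu : u ∈ colGroup y T i) :
    (π (y l i ^ r * u) • (Pi.single i 1 : ι → ZMod 4)) l = r := by
  obtain ⟨h₁, h₂⟩ := h.col_coord hπ hT u hu
  rw [map_mul, mul_smul, pow_smul_apply hπ hli, h₂ l hl hli, h₁]
  simp

omit hπ [DecidableEq ι] [Fintype ι] in
theorem pow_eq_of_cast {i j : ι} (hij : i ≠ j) {r s : ℕ} (e : (r : ZMod 4) = s) :
    y i j ^ r = y i j ^ s := by
  rw [ZMod.natCast_eq_natCast_iff] at e
  exact pow_eq_pow_of_modEq e (h.pow_four i j hij)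

/-- An element of a column group is determined by its column. -/
theorem col_injective {i : ι} (T : Finset ι) : i ∉ T → ∀ u ∈ colGroup y (T : Set ι) i,
    (∀ l ∈ T, (π u • (Pi.single i 1 : ι → ZMod 4)) l = 0) → u = 1 := by
  classical
  induction T using Finset.induction_on with
  | empty => intro _ u hu _; simpa [colGroup] using hu
  | insert k T hk ih =>
    intro hi u hu h0
    rw [Finset.mem_insert, not_or] at hi
    have hki : k ≠ i := Ne.symm hi.1
    obtain ⟨r, u', hu', rfl⟩ := exists_pow_mul_of_mem_closure (z := fun j => y j i) (k := k)
      (fun j hj => h.pow_four j i (fun e => by subst e; simp_all))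
      (fun j hj => h.comm k i j i hki (fun e => by subst e; simp_all)
        (fun e => by subst e; simp_all) hki) u hu
    have hT : ((insert k T : Finset ι) : Set ι) \ {k} = T := by ext; simp; grind
    rw [hT] at hu'
    have e := h.col_pow_coord hπ (T := T) (by simpa using hi.2) (by simpa using hk) hki r u' hu'
    rw [h0 k (by simp)] at e
    have e' : y k i ^ r = 1 := by
      rw [h.pow_eq_of_cast hki (s := 0) (by simpa using e.symm), pow_zero]
    simp only [e', one_mul] at h0 ⊢
    exact ih hi.2 u' hu' fun l hl => h0 l (by simp [hl])

theorem row_coord {i : ι} {T : Set ι} (hT : i ∉ T) (u : E) (hu : u ∈ rowGroup y T i)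
    (v : ι → ZMod 4) :
    (∀ l, l ≠ i → (π u • v) l = v l) ∧ ((∀ l ∈ T, v l = 0) → (π u • v) i = v i) := by
  have ne : ∀ j ∈ T, i ≠ j := fun j hj e => hT (e ▸ hj)
  refine closure_induction_of_pow_four (p := fun u => (∀ l, l ≠ i → (π u • v) l = v l) ∧
      ((∀ l ∈ T, v l = 0) → (π u • v) i = v i)) ?_ ?_ ?_ u hu
  · rintro _ ⟨j, hj, rfl⟩
    exact h.pow_four _ _ (ne j hj)
  · simp
  · rintro _ ⟨j, hj, rfl⟩ u ⟨h₁, h₂⟩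
    simp only [map_mul, mul_smul, smul_apply hπ (ne j hj)]
    refine ⟨fun l hl => by rw [if_neg hl, h₁ l hl, add_zero], fun h0 => ?_⟩
    simp [h₂ h0, h₁ j (ne j hj).symm, h0 j hj]

/-- An element of a row group is determined by its row. -/
theorem row_injective {i : ι} (T : Finset ι) : i ∉ T → ∀ u ∈ rowGroup y (T : Set ι) i,
    (∀ l ∈ T, (π u • (Pi.single l 1 : ι → ZMod 4)) i = 0) → u = 1 := by
  classical
  induction T using Finset.induction_on with
  | empty => intro _ u hu _; simpa [rowGroup] using hu
  | insert k T hk ih =>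
    intro hi u hu h0
    rw [Finset.mem_insert, not_or] at hi
    have hik : i ≠ k := hi.1
    obtain ⟨r, u', hu', rfl⟩ := exists_pow_mul_of_mem_closure (z := fun j => y i j) (k := k)
      (fun j hj => h.pow_four i j (fun e => by subst e; simp_all))
      (fun j hj => h.comm i k i j hik (fun e => by subst e; simp_all)
        hik.symm (fun e => by subst e; simp_all)) u hu
    have hT : ((insert k T : Finset ι) : Set ι) \ {k} = T := by ext; simp; grind
    rw [hT] at hu'
    have e := h.row_coord hπ (T := T) (by simpa using hi.2) u' hu' (Pi.single k 1)
    have e₀ := h0 k (by simp)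
    rw [map_mul, mul_smul, pow_smul_apply hπ hik, e.1 k hik.symm,
      e.2 fun l hl => Pi.single_eq_of_ne (by rintro rfl; exact hk hl) _] at e₀
    have e' : y i k ^ r = 1 := by
      rw [h.pow_eq_of_cast hik (s := 0) (by simpa [hik] using e₀), pow_zero]
    simp only [e', one_mul] at h0 ⊢
    exact ih hi.2 u' hu' fun l hl => h0 l (by simp [hl])

end

end SteinbergFamily

namespace SteinbergFamily

section Generators

variable {ι E : Type*} {y : ι → ι → E}

/-- The generators with both indices in `S`. -/
def gens (y : ι → ι → E) (S : Set ι) : Set E :=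
  {x | ∃ i ∈ S, ∃ j ∈ S, i ≠ j ∧ y i j = x}

theorem gens_of_subsingleton {S : Set ι} (hS : S.Subsingleton) : gens y S = ∅ := by
  ext x
  simp only [gens, Set.mem_ofPred_eq, Set.mem_empty_iff_false, iff_false]
  rintro ⟨i, hi, j, hj, hij, -⟩
  exact hij (hS hi hj)

end Generators

variable {ι E : Type*} [Group E] {y : ι → ι → E}

theorem pow_four_of_mem_gens (h : SteinbergFamily y) {S : Set ι} : ∀ x ∈ gens y S, x ^ 4 = 1 := by
  rintro _ ⟨i, -, j, -, hij, rfl⟩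
  exact h.pow_four i j hij

variable [DecidableEq ι] [Fintype ι] {π : E →* Matrix.SpecialLinearGroup ι (ZMod 4)}

/-- The elements of `K` send the basis vector at `o` to itself up to sign. -/
def FixesUpToSign (π : E →* Matrix.SpecialLinearGroup ι (ZMod 4)) (K : Subgroup E) (o : ι) : Prop :=
  ∀ k ∈ K, π k • (Pi.single o 1 : ι → ZMod 4) = Pi.single o 1 ∨
    π k • (Pi.single o 1 : ι → ZMod 4) = - Pi.single o 1

theorem FixesUpToSign.closure {s : Set E} {o : ι} (hs : ∀ k ∈ s,
    π k • (Pi.single o 1 : ι → ZMod 4) = Pi.single o 1 ∨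
      π k • (Pi.single o 1 : ι → ZMod 4) = - Pi.single o 1) :
    FixesUpToSign π (Subgroup.closure s) o := by
  intro k hk
  induction hk using Subgroup.closure_induction with
  | mem x hx => exact hs x hx
  | one => simp
  | mul a b _ _ ha hb =>
    rw [map_mul, mul_smul]
    rcases ha with ha | ha <;> rcases hb with hb | hb <;> simp [ha, hb]
  | inv a _ ha =>
    rw [map_inv, inv_smul_eq_iff, inv_smul_eq_iff, smul_neg]
    rcases ha with ha | ha <;> simp [ha]

variable (h : SteinbergFamily y) (hπ : Elementary y π) {S : Set ι} {o : ι} {K : Subgroup E}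
  (hK : ContainsParabolic y S o K) (hs : FixesUpToSign π K o)

include hπ hs in
theorem smul_eq_of_mk_eq {i : ι} {g u : E} (e : (g : E ⧸ K) = u • coset y K o i) :
    π g • (Pi.single o 1 : ι → ZMod 4) = π u • Pi.single i 1 ∨
      π g • (Pi.single o 1 : ι → ZMod 4) = - (π u • Pi.single i 1) := by
  obtain ⟨w, hw, ew⟩ : ∃ w : E, coset y K o i = w ∧
      π w • (Pi.single o 1 : ι → ZMod 4) = Pi.single i 1 := by
    unfold coset
    split_ifs with hio
    · exact ⟨1, rfl, by simp [hio]⟩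
    · refine ⟨_, rfl, ?_⟩
      ext k
      rw [weyl_smul_apply hπ hio]
      by_cases hk : k = i
      · simp [hk]
      · by_cases hko : k = o
        · simp [hko, hio, Ne.symm hio]
        · simp [hk, hko]
  rw [hw, MulAction.Quotient.smul_coe, smul_eq_mul] at e
  have hm := QuotientGroup.eq.1 e.symm
  have eg : g = u * w * ((u * w)⁻¹ * g) := by group
  rw [eg, map_mul, mul_smul]
  rcases hs _ hm with e' | e' <;> rw [e'] <;> simp [mul_smul, ew]

include h hπ hK hs

/-- The coset of an element is determined, up to the obvious ambiguity, by the image of the base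
vector: for every odd coordinate `i` of that vector the coset lies in the column orbit of `i`. -/
theorem exists_col_of_odd : ∀ g ∈ Subgroup.closure (gens y S), ∀ i ∈ S,
    2 * (π g • (Pi.single o 1 : ι → ZMod 4)) i = 2 →
      ∃ u ∈ colGroup y (S \ {i}) i, (g : E ⧸ K) = u • coset y K o i := by
  refine closure_induction_of_pow_four h.pow_four_of_mem_gens ?_ ?_
  · intro i _ hv
    have hio : i = o := by
      by_contra hio
      rw [map_one, one_smul, Pi.single_eq_of_ne hio, mul_zero] at hv
      exact absurd hv (by decide)
    subst hio
    exact ⟨1, one_mem _, by simp [coset]⟩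
  · rintro _ ⟨k, hk, l, hl, hkl, rfl⟩ g ih i hi hv
    rw [map_mul, mul_smul, smul_apply hπ hkl] at hv
    have hmul : ((y k l * g : E) : E ⧸ K) = y k l • (g : E ⧸ K) := rfl
    rw [hmul]
    by_cases hik : i = k
    · subst hik
      rw [if_pos rfl] at hv
      have parity : ∀ a b : ZMod 4, 2 * (a + b) = 2 →
          (2 * a = 2 ∧ 2 * b = 0) ∨ (2 * b = 2 ∧ 2 * a = 0) := by decide
      have even : ∀ r v : ZMod 4, (v = r ∨ v = - r) → 2 * v = 0 → r = 0 ∨ r = 2 := by decide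
      have coord : ∀ {a b : ι}, a ≠ b → ∀ r : ℕ, ∀ u ∈ colGroup y ((S \ {b}) \ {a}) b,
          (g : E ⧸ K) = (y a b ^ r * u) • coset y K o b →
          2 * (π g • (Pi.single o 1 : ι → ZMod 4)) a = 0 → (r : ZMod 4) = 0 ∨ (r : ZMod 4) = 2 := by
        intro a b hab r u hu e hv
        have ec := h.col_pow_coord hπ (T := (S \ {b}) \ {a}) (by simp) (by simp) hab r u hu
        refine even r _ ?_ hv
        rcases smul_eq_of_mk_eq hπ hs e with e' | e'
        · left; rw [e', ec]
        · right; rw [e', Pi.neg_apply, ec]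
      rcases parity _ _ hv with ⟨h₁, h₂⟩ | ⟨h₁, h₂⟩
      · obtain ⟨u, hu, e⟩ := ih i hi h₁
        obtain ⟨r, u', hu', rfl⟩ := h.col_split u hu hkl.symm
        rcases coord hkl.symm r u' hu' e h₂ with hr | hr
        · rw [h.pow_eq_of_cast hkl.symm (s := 0) (by simpa using hr), pow_zero, one_mul] at e
          rw [e, h.smul_col_smul_coset hK hi hl hkl.symm u' hu']
          exact ⟨u', col_mono hu', rfl⟩
        · rw [h.pow_eq_of_cast hkl.symm (s := 2) (by simpa using hr)] at e
          rw [e]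
          exact h.smul_sq_mul_col hK hi hl hkl.symm u' hu'
      · obtain ⟨u, hu, e⟩ := ih l hl h₁
        obtain ⟨r, u', hu', rfl⟩ := h.col_split u hu hkl
        have sw := h.swap_col hK hi hl hkl u' hu'
        have e₁ : y i l • (g : E ⧸ K) = (y i l ^ (r + 1) * u') • coset y K o l := by
          rw [e, smul_smul, pow_succ', mul_assoc]
        rw [e₁]
        rcases coord hkl r u' hu' e h₂ with hr | hr
        · rw [h.pow_eq_of_cast hkl (s := 1) (by push_cast; rw [hr]; rfl), pow_one]
          exact sw.1
        · rw [h.pow_eq_of_cast hkl (s := 3) (by push_cast; rw [hr]; rfl), ← h.inv_eq_pow hkl]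
          exact sw.2
    · rw [if_neg hik, add_zero] at hv
      obtain ⟨u, hu, e⟩ := ih i hi hv
      rw [e]
      exact h.smul_col_of_ne hK hi hk hl hkl (Ne.symm hik) u hu

end SteinbergFamily

namespace SteinbergFamily

variable {ι E : Type*} [Group E] {y : ι → ι → E}

/-- The generators of the subgroup of `closure (gens y (insert o T))` fixing the line through the
basis vector at `o`. -/
def parabolicGens (y : ι → ι → E) (T : Set ι) (o : ι) : Set E :=
  {x | (∃ i ∈ insert o T, ∃ j ∈ T, i ≠ j ∧ y i j = x) ∨ ∃ k ∈ T, weyl y o k ^ 2 = x}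

theorem containsParabolic_closure {T : Set ι} {o : ι} :
    ContainsParabolic y (insert o T) o (Subgroup.closure (parabolicGens y T o)) where
  base := Set.mem_insert o T
  elem i hi j hj hij hjo := Subgroup.subset_closure
    (Or.inl ⟨i, hi, j, (Set.mem_insert_iff.1 hj).resolve_left hjo, hij, rfl⟩)
  sq k hk hko := Subgroup.subset_closure
    (Or.inr ⟨k, (Set.mem_insert_iff.1 hk).resolve_left hko, rfl⟩)

variable (h : SteinbergFamily y) (hw : ∀ i j, i ≠ j → weyl y i j ^ 4 = 1)
include h

omit h in
theorem weyl_sq_mem_closure {T : Set ι} {i j : ι} (hi : i ∈ T) (hj : j ∈ T) (hij : i ≠ j) :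
    weyl y i j ^ 2 ∈ Subgroup.closure (gens y T) := by
  have a : y i j ∈ Subgroup.closure (gens y T) :=
    Subgroup.subset_closure ⟨i, hi, j, hj, hij, rfl⟩
  have b : y j i ∈ Subgroup.closure (gens y T) :=
    Subgroup.subset_closure ⟨j, hj, i, hi, hij.symm, rfl⟩
  exact pow_mem (mul_mem (mul_mem a (inv_mem b)) a) 2

theorem exists_mul_row {T : Set ι} {o i j : ι} (ho : o ∉ T) (hi : i ∈ T) (hj : j ∈ T)
    (hij : i ≠ j) :
    ∀ u ∈ rowGroup y T o, ∃ u' ∈ rowGroup y T o, y i j * u = u' * y i j := by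
  refine exists_mem_mul_eq_mul ?_
  have ne : ∀ {m}, m ∈ T → o ≠ m := fun hm e => ho (e ▸ hm)
  have mem : ∀ m ∈ T, y o m ∈ rowGroup y T o := fun m hm => Subgroup.subset_closure ⟨m, hm, rfl⟩
  rintro _ ⟨m, hm, rfl⟩
  by_cases hmi : m = i
  · subst hmi
    exact ⟨(y o j)⁻¹ * y o m, mul_mem (inv_mem (mem j hj)) (mem m hm), by
      rw [mul_assoc, h.bracket o m j (ne hm) hij (ne hj)]; group⟩
  · exact ⟨_, mem m hm, h.comm i j o m hij (ne hm) (ne hj).symm (Ne.symm hmi)⟩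

theorem exists_weyl_sq_mul_row {T : Set ι} {o k : ι} (ho : o ∉ T) (hk : k ∈ T) :
    ∀ u ∈ rowGroup y T o, ∃ u' ∈ rowGroup y T o, weyl y o k ^ 2 * u = u' * weyl y o k ^ 2 := by
  refine exists_mem_mul_eq_mul ?_
  have ne : ∀ {m}, m ∈ T → o ≠ m := fun hm e => ho (e ▸ hm)
  have mem : ∀ m ∈ T, y o m ∈ rowGroup y T o := fun m hm => Subgroup.subset_closure ⟨m, hm, rfl⟩
  rintro _ ⟨m, hm, rfl⟩
  by_cases hmk : m = k
  · subst hmk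
    have s := h.semiconj_self (ne hm)
    have s' := s.2.inv_right.mul_left s.1
    rw [inv_inv, ← sq] at s'
    exact ⟨_, mem m hm, s'⟩
  · exact ⟨_, inv_mem (mem m hm), (h.sq_semiconj_row (ne hk) (ne hm).symm hmk).2⟩

theorem exists_weyl_sq_mul_closure {T : Set ι} {o k : ι} (ho : o ∉ T) (hk : k ∈ T) :
    ∀ l ∈ Subgroup.closure (gens y T), ∃ l' ∈ Subgroup.closure (gens y T),
      weyl y o k ^ 2 * l = l' * weyl y o k ^ 2 := by
  refine exists_mem_mul_eq_mul ?_
  have ne : ∀ {m}, m ∈ T → m ≠ o := fun hm e => ho (e ▸ hm)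
  rintro _ ⟨i, hi, j, hj, hij, rfl⟩
  have mem : y i j ∈ Subgroup.closure (gens y T) :=
    Subgroup.subset_closure ⟨i, hi, j, hj, hij, rfl⟩
  by_cases hik : i = k
  · subst hik
    exact ⟨_, inv_mem mem, (h.sq_semiconj_row (ne hk).symm (ne hj) hij.symm).1⟩
  · by_cases hjk : j = k
    · subst hjk
      exact ⟨_, inv_mem mem, (h.sq_semiconj_col (ne hk).symm (ne hi) hij).1⟩
    · exact ⟨_, mem, (h.commute_weyl (ne hk).symm hij (ne hi) hik (ne hj) hjk).pow_left 2⟩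

include hw

/-- Every element of the parabolic subgroup is a product of a row element, an element of the smaller
elementary group, and possibly one diagonal element. -/
theorem exists_parabolic_decomposition {T : Set ι} {o k₀ : ι} (ho : o ∉ T) (hk₀ : k₀ ∈ T) :
    ∀ g ∈ Subgroup.closure (parabolicGens y T o), ∃ u ∈ rowGroup y T o,
      ∃ l ∈ Subgroup.closure (gens y T), ∃ e, (e = 1 ∨ e = weyl y o k₀ ^ 2) ∧ g = u * l * e := by
  have ne : ∀ {m}, m ∈ T → o ≠ m := fun hm e => ho (e ▸ hm)
  refine closure_induction_of_pow_four ?_ ⟨1, one_mem _, 1, one_mem _, 1, Or.inl rfl, by simp⟩ ?_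
  · rintro _ (⟨i, hi, j, hj, hij, rfl⟩ | ⟨k, hk, rfl⟩)
    · exact h.pow_four i j hij
    · rw [← pow_mul, mul_comm, pow_mul, hw _ _ (ne hk), one_pow]
  · rintro _ hx _ ⟨u, hu, l, hl, e, he, rfl⟩
    rcases hx with ⟨i, hi, j, hj, hij, rfl⟩ | ⟨k, hk, rfl⟩
    · rcases hi with rfl | hi
      · exact ⟨y i j * u, mul_mem (Subgroup.subset_closure ⟨j, hj, rfl⟩) hu, l, hl, e, he, by
          simp only [mul_assoc]⟩
      · obtain ⟨u', hu', eu⟩ := h.exists_mul_row ho hi hj hij u hu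
        refine ⟨u', hu', y i j * l,
          mul_mem (Subgroup.subset_closure ⟨i, hi, j, hj, hij, rfl⟩) hl, e, he, ?_⟩
        rw [← mul_assoc, ← mul_assoc, eu]; simp only [mul_assoc]
    · obtain ⟨u', hu', eu⟩ := h.exists_weyl_sq_mul_row ho hk u hu
      obtain ⟨l', hl', el⟩ := h.exists_weyl_sq_mul_closure ho hk l hl
      have inv_sq : ∀ {m}, m ∈ T → weyl y m o ^ 2 = weyl y o m ^ 2 := by
        intro m hm
        rw [h.weyl_swap (ne hm), inv_pow, inv_eq_iff_mul_eq_one, ← pow_add]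
        exact hw o m (ne hm)
      obtain ⟨m, hm, em⟩ : ∃ m ∈ Subgroup.closure (gens y T),
          weyl y o k ^ 2 = m * weyl y o k₀ ^ 2 := by
        by_cases hkk : k = k₀
        · subst hkk; exact ⟨1, one_mem _, (one_mul _).symm⟩
        · refine ⟨_, weyl_sq_mem_closure hk hk₀ hkk, ?_⟩
          rw [← inv_sq hk, ← inv_sq hk₀]
          exact h.weyl_sq_mul hkk (ne hk) (ne hk₀)
      refine ⟨u', hu', l' * m, mul_mem hl' hm, weyl y o k₀ ^ 2 * e, ?_, ?_⟩
      · rcases he with rfl | rfl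
        · exact Or.inr (mul_one _)
        · exact Or.inl (by rw [← pow_add]; exact hw o k₀ (ne hk₀))
      · rw [← mul_assoc, ← mul_assoc, eu, mul_assoc u', el, em]; simp only [mul_assoc]

variable [DecidableEq ι] [Fintype ι] {π : E →* Matrix.SpecialLinearGroup ι (ZMod 4)}
  (hπ : Elementary y π)

omit hw in
include hπ in
theorem closure_smul_apply {T : Set ι} {o : ι} (ho : o ∉ T) (l : E)
    (hl : l ∈ Subgroup.closure (gens y T)) (v : ι → ZMod 4) : (π l • v) o = v o := by
  refine closure_induction_of_pow_four (p := fun l => (π l • v) o = v o)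
    h.pow_four_of_mem_gens (by simp) ?_ l hl
  rintro _ ⟨i, hi, j, hj, hij, rfl⟩ g ih
  rw [map_mul, mul_smul, smul_apply hπ hij, ih, if_neg (by rintro rfl; exact ho hi), add_zero]

include hπ

omit h hw in
theorem fixesUpToSign_closure {T : Set ι} {o : ι} (ho : o ∉ T) :
    FixesUpToSign π (Subgroup.closure (parabolicGens y T o)) o := by
  refine FixesUpToSign.closure ?_
  rintro _ (⟨i, hi, j, hj, hij, rfl⟩ | ⟨k, hk, rfl⟩)
  · left
    ext m
    rw [smul_apply hπ hij, Pi.single_eq_of_ne (show j ≠ o by rintro rfl; exact ho hj)]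
    simp
  · right
    have hok : o ≠ k := by rintro rfl; exact ho hk
    ext m
    rw [weyl_sq_smul_apply hπ hok]
    by_cases hm : m = o
    · simp [hm]
    · simp [hm]

theorem parabolic_injective {T : Finset ι} {o : ι} (ho : o ∉ T) (hT : T.Nonempty)
    (ih : ∀ g ∈ Subgroup.closure (gens y (T : Set ι)), π g = 1 → g = 1) :
    ∀ g ∈ Subgroup.closure (parabolicGens y (T : Set ι) o), π g = 1 → g = 1 := by
  obtain ⟨k₀, hk₀⟩ := hT
  have ho' : o ∉ (T : Set ι) := by simpa using ho
  have hok : o ≠ k₀ := by rintro rfl; exact ho hk₀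
  intro g hg hg1
  obtain ⟨u, hu, l, hl, e, he, rfl⟩ := h.exists_parabolic_decomposition hw ho'
    (Finset.mem_coe.2 hk₀) g hg
  have he1 : e = 1 := by
    refine he.resolve_right ?_
    rintro rfl
    have e₁ : (π (u * l * weyl y o k₀ ^ 2) • (Pi.single o 1 : ι → ZMod 4)) o = -1 := by
      have hv : π (weyl y o k₀ ^ 2) • (Pi.single o 1 : ι → ZMod 4) = Pi.single o (-1) := by
        ext m
        rw [weyl_sq_smul_apply hπ hok]
        by_cases hm : m = o <;> simp [hm]
      have hl' : π l • (Pi.single o (-1) : ι → ZMod 4) = Pi.single o (-1) := by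
        refine closure_induction_of_pow_four
          (p := fun l => π l • (Pi.single o (-1) : ι → ZMod 4) = Pi.single o (-1))
          h.pow_four_of_mem_gens (by simp) ?_ l hl
        rintro _ ⟨i, hi, j, hj, hij, rfl⟩ g ih
        rw [map_mul, mul_smul, ih]
        ext m
        rw [smul_apply hπ hij, Pi.single_eq_of_ne (show j ≠ o by rintro rfl; exact ho' hj)]
        simp
      rw [map_mul, map_mul, mul_smul, mul_smul, hv, hl', (h.row_coord hπ ho' u hu _).2]
      · simp
      · intro m hm
        exact Pi.single_eq_of_ne (show m ≠ o by rintro rfl; exact ho' hm) _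
    rw [hg1, one_smul, Pi.single_eq_same] at e₁
    exact absurd e₁ (by decide)
  subst he1
  rw [mul_one] at hg1 ⊢
  have hu1 : u = 1 := by
    refine h.row_injective hπ T ho u hu fun m hm => ?_
    have : π u = π l⁻¹ := by
      rw [map_mul] at hg1
      rw [map_inv, eq_inv_of_mul_eq_one_left hg1]
    rw [this, h.closure_smul_apply hπ ho' _ (inv_mem hl)]
    exact Pi.single_eq_of_ne (show o ≠ m by rintro rfl; exact ho hm) _
  subst hu1
  rw [one_mul] at hg1 ⊢
  exact ih l hl hg1

theorem closure_injective (S : Finset ι) :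
    ∀ g ∈ Subgroup.closure (gens y (S : Set ι)), π g = 1 → g = 1 := by
  induction S using Finset.induction_on with
  | empty =>
    intro g hg _
    rw [gens_of_subsingleton (by simp), Subgroup.closure_empty] at hg
    exact hg
  | insert o T ho ih =>
    intro g hg hg1
    rcases T.eq_empty_or_nonempty with rfl | hT
    · rw [gens_of_subsingleton (by simp), Subgroup.closure_empty] at hg
      exact hg
    · refine h.parabolic_injective hw hπ ho hT ih g ?_ hg1
      have ho' : o ∉ (T : Set ι) := by simpa using ho
      have hK := containsParabolic_closure (y := y) (T := (T : Set ι)) (o := o)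
      have hs := fixesUpToSign_closure hπ ho'
      rw [Finset.coe_insert] at hg
      obtain ⟨u, hu, e⟩ := h.exists_col_of_odd hπ hK hs g hg o hK.base (by simp [hg1])
      have hT' : insert o (T : Set ι) \ {o} = T := by
        ext x
        simp only [Set.mem_sdiff, Set.mem_insert_iff, Set.mem_singleton_iff]
        grind
      rw [hT'] at hu
      have hu1 : u = 1 := by
        refine h.col_injective hπ T ho u hu fun m hm => ?_
        have hmo : m ≠ o := by rintro rfl; exact ho hm
        rcases smul_eq_of_mk_eq hπ hs e with e' | e' <;>
        · have := congrFun e' m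
          rw [hg1, one_smul, Pi.single_eq_of_ne hmo] at this
          simpa using this.symm
      rw [hu1, one_smul, coset, if_pos rfl] at e
      simpa using QuotientGroup.eq.1 e.symm

/-- A group generated by a Steinberg family with `weyl ^ 4 = 1` maps injectively to the special
linear group. -/
theorem eq_one_of_mem_closure : ∀ g ∈ Subgroup.closure (gens y Set.univ), π g = 1 → g = 1 := by
  simpa using h.closure_injective hw hπ Finset.univ

end SteinbergFamily

namespace TransvectionGeneration

open Matrix.SpecialLinearGroup

variable {ι R : Type*} [DecidableEq ι] [Fintype ι] [CommRing R]

theorem transvection_mul_apply {i j : ι} (hij : i ≠ j) (b : R)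
    (A : Matrix.SpecialLinearGroup ι R) (k l : ι) :
    (transvection hij b * A).1 k l = A.1 k l + if k = i then b * A.1 j l else 0 := by
  rw [← smul_single_apply, mul_smul, transvection_smul_apply, smul_single_apply, smul_single_apply]

variable (ι R) in
/-- The subgroup generated by all transvections. -/
def elementary : Subgroup (Matrix.SpecialLinearGroup ι R) :=
  Subgroup.closure {A | ∃ (i j : ι) (hij : i ≠ j) (b : R), transvection hij b = A}

theorem transvection_mem {i j : ι} (hij : i ≠ j) (b : R) :
    transvection hij b ∈ elementary ι R :=
  Subgroup.subset_closure ⟨i, j, hij, b, rfl⟩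

/-- The columns of `A` outside `S` agree with those of the identity matrix. -/
def FixesOutside (S : Set ι) (A : Matrix.SpecialLinearGroup ι R) : Prop :=
  ∀ j ∉ S, ∀ k, A.1 k j = (1 : Matrix ι ι R) k j

theorem FixesOutside.transvection_mul {S : Set ι} {A : Matrix.SpecialLinearGroup ι R}
    (hA : FixesOutside S A) {i j : ι} (hij : i ≠ j) (hj : j ∈ S) (b : R) :
    FixesOutside S (transvection hij b * A) := by
  intro l hl k
  rw [transvection_mul_apply, hA l hl k, hA l hl j,
    Matrix.one_apply_ne (show j ≠ l by rintro rfl; exact hl hj)]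
  simp

theorem exists_clear_column {S : Set ι} {o : ι} (ho : o ∈ S) (T : Finset ι) (hoT : o ∉ T)
    (A : Matrix.SpecialLinearGroup ι R) (hA : FixesOutside S A) (hA1 : A.1 o o = 1) :
    ∃ M ∈ elementary ι R, FixesOutside S (M * A) ∧ (M * A).1 o o = 1 ∧
      ∀ i ∈ T, (M * A).1 i o = 0 := by
  induction T using Finset.induction_on with
  | empty => exact ⟨1, one_mem _, by simpa using hA, by simpa using hA1, by simp⟩
  | insert i T hi ih =>
    rw [Finset.mem_insert, not_or] at hoT
    obtain ⟨M, hM, h₁, h₂, h₃⟩ := ih hoT.2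
    have hio : i ≠ o := Ne.symm hoT.1
    refine ⟨transvection hio (-(M * A).1 i o) * M, mul_mem (transvection_mem _ _) hM, ?_, ?_, ?_⟩
    · rw [mul_assoc]
      exact h₁.transvection_mul hio ho _
    · rw [mul_assoc, transvection_mul_apply, if_neg hoT.1, h₂, add_zero]
    · intro k hk
      rw [mul_assoc, transvection_mul_apply, h₂]
      by_cases hki : k = i
      · simp [hki]
      · rw [if_neg hki, h₃ k ((Finset.mem_insert.1 hk).resolve_left hki), add_zero]

theorem inv_fixesOutside {S : Set ι} {A : Matrix.SpecialLinearGroup ι R} (hA : FixesOutside S A) :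
    FixesOutside S A⁻¹ := by
  intro j hj k
  have : A • (Pi.single j 1 : ι → R) = Pi.single j 1 := by
    ext k
    rw [smul_single_apply, hA j hj, Matrix.one_apply, Pi.single_apply]
  rw [← smul_single_apply, inv_smul_eq_iff.2 this.symm, Matrix.one_apply, Pi.single_apply]

theorem exists_isUnit [IsLocalRing R] {S : Finset ι} {o : ι} {A : Matrix.SpecialLinearGroup ι R}
    (hA : FixesOutside (S : Set ι) A) (ho : o ∈ S) : ∃ i ∈ S, IsUnit (A.1 i o) := by
  by_contra! hno
  have e : (A⁻¹ * A).1 o o = 1 := by simp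
  rw [coe_mul, Matrix.mul_apply] at e
  have : ∀ i, (A⁻¹).1 o i * A.1 i o ∈ IsLocalRing.maximalIdeal R := by
    intro i
    by_cases hi : i ∈ S
    · exact Ideal.mul_mem_left _ _ (hno i hi)
    · rw [inv_fixesOutside hA i (by simpa using hi),
        Matrix.one_apply_ne (show o ≠ i by rintro rfl; exact hi ho), zero_mul]
      exact zero_mem _
  have := Ideal.sum_mem _ (fun i (_ : i ∈ Finset.univ) => this i)
  rw [e] at this
  exact (Ideal.ne_top_iff_one _).1 (IsLocalRing.maximalIdeal.isMaximal R).ne_top this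

theorem exists_diag_eq_one [IsLocalRing R] {T : Finset ι} {o : ι} (hoT : o ∉ T)
    (A : Matrix.SpecialLinearGroup ι R) (hA : FixesOutside ((insert o T : Finset ι) : Set ι) A) :
    ∃ M ∈ elementary ι R, FixesOutside ((insert o T : Finset ι) : Set ι) (M * A) ∧
      (M * A).1 o o = 1 := by
  have off : ∀ {B : Matrix.SpecialLinearGroup ι R},
      FixesOutside ((insert o T : Finset ι) : Set ι) B → ∀ k ∈ T, IsUnit (B.1 k o) →
      ∃ M ∈ elementary ι R, FixesOutside ((insert o T : Finset ι) : Set ι) (M * B) ∧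
        (M * B).1 o o = 1 := by
    intro B hB k hk hu
    have hok : o ≠ k := by rintro rfl; exact hoT hk
    obtain ⟨u, hu⟩ := hu
    refine ⟨transvection hok ((1 - B.1 o o) * (u⁻¹ : Rˣ)), transvection_mem _ _,
      hB.transvection_mul hok (by simp [hk]) _, ?_⟩
    rw [transvection_mul_apply, if_pos rfl, ← hu, mul_assoc, Units.inv_mul]
    ring
  rcases T.eq_empty_or_nonempty with rfl | ⟨k, hk⟩
  · refine ⟨1, one_mem _, by simpa using hA, ?_⟩
    have e : A.1 = Matrix.updateCol 1 o (fun i => A.1 i o) := by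
      ext i j
      by_cases hj : j = o
      · subst hj; simp
      · rw [Matrix.updateCol_ne hj, hA j (by simpa using hj)]
    have d := A.2
    rw [e, ← Matrix.cramer_apply, Matrix.cramer_one] at d
    simpa using d
  · obtain ⟨i, hi, hu⟩ := exists_isUnit hA (Finset.mem_insert_self o T)
    rcases Finset.mem_insert.1 hi with rfl | hi
    · have hki : k ≠ i := by rintro rfl; exact hoT hk
      obtain ⟨u, hu⟩ := hu
      have hB := hA.transvection_mul hki (by simp) ((1 - A.1 k i) * (u⁻¹ : Rˣ))
      obtain ⟨M, hM, h₁, h₂⟩ := off hB k hk (by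
        rw [transvection_mul_apply, if_pos rfl, ← hu, mul_assoc, Units.inv_mul]
        simp)
      exact ⟨M * _, mul_mem hM (transvection_mem hki _), by rwa [mul_assoc], by rwa [mul_assoc]⟩
    · exact off hA i hi hu

theorem mem_elementary_of_fixesOutside [IsLocalRing R] (S : Finset ι) :
    ∀ A : Matrix.SpecialLinearGroup ι R, FixesOutside (S : Set ι) A → A ∈ elementary ι R := by
  induction S using Finset.induction_on with
  | empty =>
    intro A hA
    have : A = 1 := Subtype.ext (by ext i j; exact hA j (by simp) i)
    rw [this]
    exact one_mem _
  | insert o T ho ih =>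
    intro A hA
    obtain ⟨M, hM, h₁, h₂⟩ := exists_diag_eq_one ho A hA
    obtain ⟨N, hN, h₃, h₄, h₅⟩ := exists_clear_column (S := ((insert o T : Finset ι) : Set ι))
      (by simp) (Finset.univ.erase o) (by simp) _ h₁ h₂
    have : N * (M * A) ∈ elementary ι R := by
      refine ih _ fun j hj k => ?_
      by_cases hjo : j = o
      · subst hjo
        by_cases hk : k = j
        · rw [hk, h₄, Matrix.one_apply_eq]
        · rw [h₅ k (by simpa using hk), Matrix.one_apply_ne hk]
      · exact h₃ j (by simpa [hjo] using hj) k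
    rwa [Subgroup.mul_mem_cancel_left _ hN, Subgroup.mul_mem_cancel_left _ hM] at this

variable (ι R) in
theorem elementary_eq_top [IsLocalRing R] : elementary ι R = ⊤ :=
  eq_top_iff.2 fun A _ => mem_elementary_of_fixesOutside Finset.univ A fun j hj => by simp at hj

theorem transvection_one_pow {i j : ι} (hij : i ≠ j) (r : ℕ) :
    transvection hij (1 : R) ^ r = transvection hij (r : R) := by
  induction r with
  | zero => simp
  | succ r ih => rw [pow_succ, ih, ← transvection_add, Nat.cast_succ]

instance : IsLocalRing (ZMod 4) :=
  have : Nontrivial (ZMod 4) := ⟨0, 1, by decide⟩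
  IsLocalRing.of_isUnit_or_isUnit_one_sub_self fun a => by
    have : ∀ a : ZMod 4, a * a = 1 ∨ (1 - a) * (1 - a) = 1 := by decide
    exact (this a).imp (IsUnit.of_mul_eq_one _) (IsUnit.of_mul_eq_one _)

theorem closure_transvection_one :
    Subgroup.closure {A : Matrix.SpecialLinearGroup ι (ZMod 4) |
      ∃ (i j : ι) (hij : i ≠ j), transvection hij 1 = A} = ⊤ := by
  rw [eq_top_iff, ← elementary_eq_top ι (ZMod 4), elementary, Subgroup.closure_le]
  rintro _ ⟨i, j, hij, b, rfl⟩
  rw [show b = ((b.val : ℕ) : ZMod 4) by simp, ← transvection_one_pow]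
  refine SetLike.mem_coe.2 (pow_mem (Subgroup.subset_closure ?_) _)
  exact ⟨i, j, hij, rfl⟩

end TransvectionGeneration

namespace SteinbergFamily

section Matrices

variable {ι : Type*} [DecidableEq ι] [Fintype ι]

variable (ι) in
/-- The elementary matrices with off-diagonal entry `1` over `ℤ/4ℤ`. -/
def elementaryMatrix (i j : ι) : Matrix.SpecialLinearGroup ι (ZMod 4) :=
  if hij : i ≠ j then Matrix.SpecialLinearGroup.transvection hij 1 else 1

theorem elementaryMatrix_of_ne {i j : ι} (hij : i ≠ j) :
    elementaryMatrix ι i j = Matrix.SpecialLinearGroup.transvection hij 1 := dif_pos hij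

theorem eq_of_smul_apply_eq {R : Type*} [CommRing R] {A B : Matrix.SpecialLinearGroup ι R}
    (e : ∀ (v : ι → R) k, (A • v) k = (B • v) k) : A = B := by
  ext k i
  rw [← smul_single_apply, ← smul_single_apply, e]

theorem steinbergFamily_elementaryMatrix (hι : 5 ≤ Fintype.card ι) :
    SteinbergFamily (elementaryMatrix ι) where
  third i j := by
    obtain ⟨k, hk⟩ := Finset.exists_mem_notMem_of_card_lt_card
      (s := {i, j}) (t := Finset.univ) (lt_of_le_of_lt Finset.card_le_two (by simp; omega))
    exact ⟨k, by simpa using hk⟩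
  pow_four i j hij := by
    rw [elementaryMatrix_of_ne hij, TransvectionGeneration.transvection_one_pow,
      show ((4 : ℕ) : ZMod 4) = 0 from rfl, Matrix.SpecialLinearGroup.transvection_coeff_zero]
  comm i j k l hij hkl hjk hil := by
    rw [elementaryMatrix_of_ne hij, elementaryMatrix_of_ne hkl]
    refine eq_of_smul_apply_eq fun v m => ?_
    simp only [mul_smul, transvection_smul_apply, one_mul, if_neg hjk, if_neg hil.symm, add_zero]
    ring
  bracket i j k hij hjk hik := by
    rw [elementaryMatrix_of_ne hij, elementaryMatrix_of_ne hjk, elementaryMatrix_of_ne hik]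
    refine eq_of_smul_apply_eq fun v m => ?_
    simp only [mul_smul, transvection_smul_apply, one_mul, if_neg hjk.symm, if_neg hik.symm,
      add_zero, if_true]
    split_ifs <;> ring

end Matrices

open scoped commutatorElement

section Central

variable {E Q : Type*} [Group E] [Group Q] {π : E →* Q}
  (hc : ∀ z, π z = 1 → ∀ e, Commute z e)
include hc

theorem exists_central_mul {a b : E} (e : π a = π b) : ∃ z, (∀ x, Commute z x) ∧ a = z * b :=
  ⟨a * b⁻¹, hc _ (by rw [map_mul, map_inv, e, mul_inv_cancel]), by group⟩

theorem commutator_eq_of_map_eq {a a' b b' : E} (ea : π a = π a') (eb : π b = π b') :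
    ⁅a, b⁆ = ⁅a', b'⁆ := by
  obtain ⟨z, hz, rfl⟩ := exists_central_mul hc ea
  obtain ⟨w, hw, rfl⟩ := exists_central_mul hc eb
  rw [commutatorElement_def, commutatorElement_def, _root_.mul_inv_rev, _root_.mul_inv_rev]
  have h₁ : z * a' * (w * b') * (a'⁻¹ * z⁻¹) * (b'⁻¹ * w⁻¹) =
      z * (a' * w) * b' * a'⁻¹ * (z⁻¹ * (b'⁻¹ * w⁻¹)) := by group
  rw [h₁, ← (hw a').eq, ((hz (b'⁻¹ * w⁻¹)).inv_left).eq]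
  have h₂ : z * (w * a') * b' * a'⁻¹ * (b'⁻¹ * w⁻¹ * z⁻¹) =
      z * (w * (a' * b' * a'⁻¹ * b'⁻¹)) * w⁻¹ * z⁻¹ := by group
  rw [h₂, (hw _).eq, ← mul_assoc z, mul_inv_cancel_right, (hz _).eq, mul_inv_cancel_right]

theorem commute_of_map_commutator {a b c d : E} (hb : Commute (π a) (π b))
    (hc' : Commute (π a) (π c)) (hd : π d = ⁅π b, π c⁆) : Commute a d := by
  have conj : ∀ {x}, Commute (π a) (π x) → π (a * x * a⁻¹) = π x := by
    intro x hx
    rw [map_mul, map_mul, hx.eq, map_inv, mul_inv_cancel_right]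
  have e : Commute a ⁅b, c⁆ := by
    have := commutator_eq_of_map_eq hc (conj hb) (conj hc')
    rw [← conjugate_commutatorElement] at this
    exact mul_inv_eq_iff_eq_mul.1 this
  rw [← map_commutatorElement] at hd
  obtain ⟨z, hz, rfl⟩ := exists_central_mul hc hd
  exact (hz a).symm.mul_right e

end Central

section Lift

variable {ι E : Type*} [DecidableEq ι] [Fintype ι] [Group E]
  {π : E →* Matrix.SpecialLinearGroup ι (ZMod 4)}
  (hc : ∀ z, π z = 1 → ∀ e, Commute z e) (hι : 5 ≤ Fintype.card ι)
include hc hι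

theorem commute_of_map_eq {i j k l : ι} (hij : i ≠ j) (hkl : k ≠ l) (hjk : j ≠ k) (hil : i ≠ l)
    {a b : E} (ha : π a = elementaryMatrix ι i j) (hb : π b = elementaryMatrix ι k l)
    (hs : Function.Surjective π) : Commute a b := by
  have X := steinbergFamily_elementaryMatrix hι
  obtain ⟨m, hm⟩ := Finset.exists_mem_notMem_of_card_lt_card
    (s := {i, j, k, l}) (t := Finset.univ) (lt_of_le_of_lt Finset.card_le_four (by simp; omega))
  simp only [Finset.mem_univ, Finset.mem_insert, Finset.mem_singleton, not_or, true_and] at hm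
  obtain ⟨hmi, hmj, hmk, hml⟩ := hm
  obtain ⟨p, hp⟩ := hs (elementaryMatrix ι k m)
  obtain ⟨q, hq⟩ := hs (elementaryMatrix ι m l)
  refine commute_of_map_commutator hc (b := p) (c := q) ?_ ?_ ?_
  · rw [ha, hp]
    exact X.comm _ _ _ _ hij (Ne.symm hmk) hjk (Ne.symm hmi)
  · rw [ha, hq]
    exact X.comm _ _ _ _ hij hml (Ne.symm hmj) hil
  · rw [hb, hp, hq, commutatorElement_def, X.bracket k m l (Ne.symm hmk) hml hkl]
    group

theorem commutator_eq_of_ne (hs : Function.Surjective π) {t : ι → ι → E}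
    (ht : ∀ i j, π (t i j) = elementaryMatrix ι i j) {i j k m : ι} (hij : i ≠ j)
    (hki : k ≠ i) (hkj : k ≠ j) (hmi : m ≠ i) (hmj : m ≠ j) :
    ⁅t i m, t m j⁆ = ⁅t i k, t k j⁆ := by
  have X := steinbergFamily_elementaryMatrix hι
  by_cases hkm : k = m
  · rw [hkm]
  have hw : π (weyl t k m) = weyl (elementaryMatrix ι) k m := by simp [weyl, ht]
  have conj : ∀ {p q}, SemiconjBy (weyl (elementaryMatrix ι) k m) (π p) (π q) →
      π (weyl t k m * p * (weyl t k m)⁻¹) = π q := by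
    intro p q e
    rw [map_mul, map_mul, map_inv, hw, e.eq, mul_inv_cancel_right]
  have e := commutator_eq_of_map_eq hc
    (conj (p := t i m) (q := t i k) (by
      rw [ht, ht]; exact (X.semiconj_col hkm (Ne.symm hki) (Ne.symm hmi)).1))
    (conj (p := t m j) (q := t k j) (by
      rw [ht, ht]; exact (X.semiconj_row hkm (Ne.symm hkj) (Ne.symm hmj)).1))
  rw [← conjugate_commutatorElement] at e
  rw [← e, eq_mul_inv_iff_mul_eq]
  have lift : π ⁅t i m, t m j⁆ = elementaryMatrix ι i j := by
    rw [map_commutatorElement, ht, ht, commutatorElement_def,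
      X.bracket i m j (Ne.symm hmi) hmj hij]
    group
  have c₁ := commute_of_map_eq hc hι hij hkm (Ne.symm hkj) (Ne.symm hmi) lift (ht k m) hs
  have c₂ := commute_of_map_eq hc hι hij (Ne.symm hkm) (Ne.symm hmj) (Ne.symm hki) lift (ht m k) hs
  exact ((c₁.mul_right c₂.inv_right).mul_right c₁).eq

/-- A central extension of `SL(n, ℤ/4ℤ)` with `n ≥ 5` contains a Steinberg family lifting the
elementary matrices. -/
theorem exists_lift (hs : Function.Surjective π) :
    ∃ y : ι → ι → E, SteinbergFamily y ∧ Elementary y π := by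
  have X := steinbergFamily_elementaryMatrix hι
  choose t ht using fun i j => hs (elementaryMatrix ι i j)
  choose κ hκ using X.third
  have bracket : ∀ {i j k : ι}, i ≠ j → j ≠ k → i ≠ k → ∀ {a b : E},
      π a = elementaryMatrix ι i j → π b = elementaryMatrix ι j k →
      ⁅a, b⁆ = ⁅t i (κ i k), t (κ i k) k⁆ := by
    intro i j k hij hjk hik a b ha hb
    rw [commutator_eq_of_ne hc hι hs ht hik (Ne.symm hij) hjk (hκ i k).1 (hκ i k).2]
    exact commutator_eq_of_map_eq hc (ha.trans (ht i j).symm) (hb.trans (ht j k).symm)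
  have lift : ∀ {i j : ι}, i ≠ j → π ⁅t i (κ i j), t (κ i j) j⁆ = elementaryMatrix ι i j := by
    intro i j hij
    rw [map_commutatorElement, ht, ht, commutatorElement_def,
      X.bracket i (κ i j) j (hκ i j).1.symm (hκ i j).2 hij]
    group
  refine ⟨fun i j => ⁅t i (κ i j), t (κ i j) j⁆, ⟨X.third, ?_, ?_, ?_⟩, ?_⟩
  · intro i j hij
    obtain ⟨hki, hkj⟩ := hκ i j
    set a := t i (κ i j)
    set b := t (κ i j) j
    have hb : Commute ⁅a, b⁆ b :=
      commute_of_map_eq hc hι hij hkj (Ne.symm hkj) hij (lift hij) (ht _ _) hs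
    have e : ⁅a, b⁆ * b = a * b * a⁻¹ := by rw [commutatorElement_def]; group
    have e₄ := congrArg (· ^ 4) e
    simp only [hb.mul_pow, conj_pow] at e₄
    have hb4 : Commute (b ^ 4) a := hc _ (by rw [map_pow, ht, X.pow_four _ _ hkj]) a
    rwa [← hb4.eq, mul_inv_cancel_right, mul_eq_right] at e₄
  · intro i j k l hij hkl hjk hil
    exact commute_of_map_eq hc hι hij hkl hjk hil (lift hij) (lift hkl) hs
  · intro i j k hij hjk hik
    rw [← bracket hij hjk hik (lift hij) (lift hjk), commutatorElement_def]
    group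
  · intro i j hij
    rw [lift hij, elementaryMatrix_of_ne hij]

end Lift

end SteinbergFamily

section CentralCommutators

variable {E Q : Type*} [Group E] [Group Q] {p : E →* Q}

/-- The commutator of `a` and `x` is central and killed by four. -/
def CommuteUpToFour (a x : E) : Prop :=
  ∃ c : E, (∀ e, Commute c e) ∧ c ^ 4 = 1 ∧ a * x = c * (x * a)

theorem CommuteUpToFour.mul_right {a x x' : E} (h : CommuteUpToFour a x)
    (h' : CommuteUpToFour a x') : CommuteUpToFour a (x * x') := by
  obtain ⟨c, hc, c4, e⟩ := h
  obtain ⟨d, hd, d4, f⟩ := h'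
  refine ⟨c * d, fun e => (hc e).mul_left (hd e), by rw [(hc d).mul_pow, c4, d4, one_mul], ?_⟩
  calc a * (x * x') = c * (x * (a * x')) := by rw [← mul_assoc, e]; simp only [mul_assoc]
    _ = c * (x * d) * (x' * a) := by rw [f]; simp only [mul_assoc]
    _ = _ := by rw [← (hd x).eq]; simp only [mul_assoc]

theorem CommuteUpToFour.sq {a x : E} (h : CommuteUpToFour a x) : Commute (a ^ 2) (x ^ 2) := by
  obtain ⟨c, hc, c4, e⟩ := h
  have e₁ : SemiconjBy a x (c * x) := by rw [SemiconjBy, e, mul_assoc]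
  have e₂ : SemiconjBy (a * a) x (c * (c * x)) := SemiconjBy.mul_left
    (SemiconjBy.mul_right (show SemiconjBy a c c from (hc a).symm) e₁) e₁
  have e₃ := e₂.pow_right 2
  have hcx : (c * (c * x)) ^ 2 = x ^ 2 := by
    rw [← mul_assoc, (((hc x).mul_left (hc x))).mul_pow, ← pow_two, ← pow_mul, c4, one_mul]
  rw [hcx, ← pow_two] at e₃
  exact e₃

variable (hp : ∀ z, p z = 1 → ∀ e, Commute z e)
include hp

theorem commuteUpToFour_of_map {a x : E} (h : Commute (p a) (p x)) (h4 : p x ^ 4 = 1) :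
    CommuteUpToFour a x := by
  refine ⟨a * x * (x * a)⁻¹, hp _ ?_, ?_, by group⟩
  · rw [map_mul, map_inv, map_mul, map_mul, h.eq, mul_inv_cancel]
  · have hz : ∀ e, Commute (a * x * (x * a)⁻¹) e := hp _ (by
      rw [map_mul, map_inv, map_mul, map_mul, h.eq, mul_inv_cancel])
    have hx : ∀ e, Commute (x ^ 4) e := hp _ (by rw [map_pow, h4])
    have e : (a * x * (x * a)⁻¹) * x = a * x * a⁻¹ := by group
    have e₄ := congrArg (· ^ 4) e
    simp only [(hz x).mul_pow, conj_pow] at e₄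
    rwa [← (hx a).eq, mul_inv_cancel_right, mul_eq_right] at e₄

theorem commute_of_map_eq_of_commute {a b a' b' : E} (h : Commute a b) (ha : p a' = p a)
    (hb : p b' = p b) : Commute a' b' := by
  have key : ∀ {x x' : E}, p x' = p x → ∃ z, (∀ e, Commute z e) ∧ x' = z * x := fun {x x'} e =>
    ⟨x' * x⁻¹, hp _ (by rw [map_mul, map_inv, e, mul_inv_cancel]), by group⟩
  obtain ⟨z, hz, rfl⟩ := key ha
  obtain ⟨w, hw, rfl⟩ := key hb
  exact (hz _).mul_left ((hw _).symm.mul_right h)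

end CentralCommutators

namespace SpElements

variable {g : ℕ} {R : Type} [CommRing R]

/-- The upper unitriangular symplectic matrix attached to a diagonal matrix. -/
def upper (v : Fin g → R) : Sp g R :=
  ⟨Matrix.fromBlocks 1 (Matrix.diagonal v) 0 1, by
    rw [SymplecticGroup.mem_iff, Matrix.J, Matrix.fromBlocks_multiply,
      Matrix.fromBlocks_transpose, Matrix.fromBlocks_multiply]
    simp⟩

/-- The lower unitriangular symplectic matrix attached to a diagonal matrix. -/
def lower (v : Fin g → R) : Sp g R :=
  ⟨Matrix.fromBlocks 1 0 (Matrix.diagonal v) 1, by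
    rw [SymplecticGroup.mem_iff, Matrix.J, Matrix.fromBlocks_multiply,
      Matrix.fromBlocks_transpose, Matrix.fromBlocks_multiply]
    simp⟩

theorem upper_mul (v w : Fin g → R) : upper v * upper w = upper (v + w) := by
  refine Subtype.ext ?_
  change Matrix.fromBlocks _ _ _ _ * Matrix.fromBlocks _ _ _ _ = Matrix.fromBlocks _ _ _ _
  rw [Matrix.fromBlocks_multiply]
  simp [Matrix.diagonal_add, add_comm]

theorem lower_mul (v w : Fin g → R) : lower v * lower w = lower (v + w) := by
  refine Subtype.ext ?_
  change Matrix.fromBlocks _ _ _ _ * Matrix.fromBlocks _ _ _ _ = Matrix.fromBlocks _ _ _ _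
  rw [Matrix.fromBlocks_multiply]
  simp [Matrix.diagonal_add]

theorem upper_zero : upper (0 : Fin g → R) = 1 := by
  refine Subtype.ext ?_
  change Matrix.fromBlocks _ _ _ _ = (1 : Matrix _ _ R)
  simp

theorem lower_zero : lower (0 : Fin g → R) = 1 := by
  refine Subtype.ext ?_
  change Matrix.fromBlocks _ _ _ _ = (1 : Matrix _ _ R)
  simp

theorem commute_upper_lower {v w : Fin g → R} (h : v * w = 0) : Commute (upper v) (lower w) := by
  refine Subtype.ext ?_
  change Matrix.fromBlocks _ _ _ _ * Matrix.fromBlocks _ _ _ _ =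
    Matrix.fromBlocks _ _ _ _ * Matrix.fromBlocks _ _ _ _
  have h' : (fun i => v i * w i) = 0 := h
  have h'' : (fun i => w i * v i) = 0 := by simpa [mul_comm] using h'
  rw [Matrix.fromBlocks_multiply, Matrix.fromBlocks_multiply]
  simp [h', h'']

theorem upper_pow_four (v : Fin g → ZMod 4) : upper v ^ 4 = 1 := by
  have h4 : ∀ a : ZMod 4, a + a + a + a = 0 := by decide
  have hv : v + v + v + v = 0 := funext fun i => h4 (v i)
  simp only [pow_succ, pow_zero, one_mul, upper_mul, hv, upper_zero]

theorem lower_pow_four (v : Fin g → ZMod 4) : lower v ^ 4 = 1 := by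
  have h4 : ∀ a : ZMod 4, a + a + a + a = 0 := by decide
  have hv : v + v + v + v = 0 := funext fun i => h4 (v i)
  simp only [pow_succ, pow_zero, one_mul, lower_mul, hv, lower_zero]

/-- The symplectic Weyl element attached to the idempotent diagonal matrix. -/
def rot (v : Fin g → R) : Sp g R := upper v * lower (-v) * upper v

theorem coe_rot_sq {v : Fin g → R} (hv : v * v = v) :
    ((rot v ^ 2 : Sp g R) : Matrix (Fin g ⊕ Fin g) (Fin g ⊕ Fin g) R) =
      Matrix.fromBlocks (Matrix.diagonal (1 - 2 * v)) 0 0 (Matrix.diagonal (1 - 2 * v)) := by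
  have hv' : ∀ i, v i * v i = v i := congrFun hv
  rw [sq, rot]
  change (Matrix.fromBlocks _ _ _ _ * Matrix.fromBlocks _ _ _ _ * Matrix.fromBlocks _ _ _ _) *
    (Matrix.fromBlocks _ _ _ _ * Matrix.fromBlocks _ _ _ _ * Matrix.fromBlocks _ _ _ _) = _
  simp only [Matrix.fromBlocks_multiply]
  rw [← Matrix.diagonal_one]
  simp only [Matrix.diagonal_mul_diagonal, Matrix.diagonal_add, ← Matrix.diagonal_zero,
    Pi.neg_apply]
  congr 1 <;> congr 1 <;> ext i <;> have := hv' i <;> simp <;> grind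

end SpElements

namespace SpElements

variable {g : ℕ}

theorem single_mul_single {i j : Fin g} (hij : i ≠ j) (a b : ZMod 4) :
    (Pi.single i a : Fin g → ZMod 4) * Pi.single j b = 0 := by
  ext k
  by_cases hk : k = i
  · subst hk; simp [hij]
  · simp [hk]

/-- The squares of the Weyl elements at distinct indices have commuting lifts in every central
extension of the symplectic group. -/
theorem exists_lift_rot {E : Type*} [Group E] {p : E →* Sp g (ZMod 4)}
    (hp : ∀ z, p z = 1 → ∀ e, Commute z e) (hs : Function.Surjective p) :
    ∃ e : Fin g → E, (∀ i, p (e i) = rot (Pi.single i 1)) ∧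
      ∀ i j, i ≠ j → Commute (e i ^ 2) (e j ^ 2) := by
  choose x hx using fun i : Fin g => hs (upper (Pi.single i 1))
  choose z hz using fun i : Fin g => hs (lower (-Pi.single i 1))
  have he : ∀ i, p (x i * z i * x i) = rot (Pi.single i 1) := fun i => by
    rw [map_mul, map_mul, hx, hz, rot]
  refine ⟨fun i => x i * z i * x i, he, fun i j hij => ?_⟩
  have o := single_mul_single hij 1 1
  have o' := single_mul_single hij.symm 1 1
  have hux : Commute (rot (Pi.single i 1 : Fin g → ZMod 4)) (p (x j)) := by
    have c : Commute (upper (Pi.single i 1 : Fin g → ZMod 4)) (upper (Pi.single j 1)) := by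
      rw [Commute, SemiconjBy, upper_mul, upper_mul, add_comm]
    rw [hx, rot]
    exact (c.mul_left (commute_upper_lower (by rw [mul_neg, o', neg_zero])).symm).mul_left c
  have huz : Commute (rot (Pi.single i 1 : Fin g → ZMod 4)) (p (z j)) := by
    have c : Commute (lower (-Pi.single i 1 : Fin g → ZMod 4)) (lower (-Pi.single j 1)) := by
      rw [Commute, SemiconjBy, lower_mul, lower_mul, add_comm]
    have d : Commute (upper (Pi.single i 1 : Fin g → ZMod 4)) (lower (-Pi.single j 1)) :=
      commute_upper_lower (by rw [mul_neg, o, neg_zero])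
    rw [hz, rot]
    exact (d.mul_left c).mul_left d
  rw [← he] at hux huz
  have kx := commuteUpToFour_of_map hp hux (by rw [hx, upper_pow_four])
  have kz := commuteUpToFour_of_map hp huz (by rw [hz, lower_pow_four])
  exact ((kx.mul_right kz).mul_right kx).sq

theorem hyp_eq_rot_sq_mul {i j : Fin g} (hij : i ≠ j)
    {A : Matrix.SpecialLinearGroup (Fin g) (ZMod 4)}
    (hA : ∀ (v : Fin g → ZMod 4) k, (A • v) k = if k = i ∨ k = j then - v k else v k) :
    Hyp.hyp g (ZMod 4) A = rot (Pi.single i 1) ^ 2 * rot (Pi.single j 1) ^ 2 := by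
  have idem : ∀ i : Fin g, (Pi.single i 1 : Fin g → ZMod 4) * Pi.single i 1 = Pi.single i 1 :=
    fun i => by rw [← Pi.single_mul, one_mul]
  have e : A.1 = Matrix.diagonal (1 - 2 * Pi.single i 1) *
      Matrix.diagonal (1 - 2 * Pi.single j 1) := by
    ext k l
    rw [← smul_single_apply, hA, Matrix.diagonal_mul_diagonal, Matrix.diagonal_apply]
    by_cases hkl : k = l
    · subst hkl
      by_cases hi : k = i
      · subst hi; simp [hij]; decide
      · by_cases hj : k = j
        · subst hj; simp [hi]; decide
        · simp [hi, hj]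
    · simp [hkl]
  have ht : (A.1ᵀ)⁻¹ = A.1 := by
    refine Matrix.inv_eq_left_inv ?_
    rw [e, Matrix.transpose_mul, Matrix.diagonal_transpose, Matrix.diagonal_transpose]
    simp only [Matrix.diagonal_mul_diagonal]
    rw [← Matrix.diagonal_one]
    congr 1
    ext k
    have h1 : ∀ a : ZMod 4, (1 - 2 * a) * (1 - 2 * a) = 1 := by decide
    have := h1 (Pi.single (M := fun _ => ZMod 4) i 1 k)
    have := h1 (Pi.single (M := fun _ => ZMod 4) j 1 k)
    simp only [Pi.sub_apply, Pi.mul_apply, Pi.ofNat_apply]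
    grind
  refine Subtype.ext ?_
  rw [Submonoid.coe_mul, coe_rot_sq (idem i), coe_rot_sq (idem j), Matrix.fromBlocks_multiply]
  change Matrix.fromBlocks A.1 0 0 ((A.1ᵀ)⁻¹) = _
  rw [ht, e]
  simp

end SpElements

namespace SteinbergFamily

theorem weyl_pow_four {ι E : Type*} [Group E] {y : ι → ι → E} (h : SteinbergFamily y)
    (hc : ∀ i j k, i ≠ j → k ≠ i → k ≠ j → Commute (weyl y i j ^ 2) (weyl y i k ^ 2))
    {i k : ι} (hik : i ≠ k) : weyl y i k ^ 4 = 1 := by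
  obtain ⟨j, hji, hjk⟩ := h.third i k
  have r := (h.sq_semiconj_row hji.symm hik.symm hjk.symm).2
  have c := (h.sq_semiconj_col hji.symm hik.symm hjk.symm).2
  have s : SemiconjBy (weyl y i j ^ 2) (weyl y i k) (weyl y i k)⁻¹ := by
    have := (r.mul_right c.inv_right).mul_right r
    suffices e : (weyl y i k)⁻¹ = (y i k)⁻¹ * (y k i)⁻¹⁻¹ * (y i k)⁻¹ by rwa [e]
    simp [weyl, mul_assoc]
  have s₂ := (s.pow_right 2).eq
  rw [(hc i j k hji.symm hik.symm hjk.symm).eq] at s₂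
  have e := mul_right_cancel s₂
  rw [inv_pow, eq_inv_iff_mul_eq_one, ← pow_add] at e
  exact e

end SteinbergFamily

section HyperbolicLift

variable {g : ℕ} {E : Type*} [Group E] {p : E →* Sp g (ZMod 4)}

/-- The pullback of `p` along the hyperbolization homomorphism. -/
def pullback (p : E →* Sp g (ZMod 4)) :
    Subgroup (Matrix.SpecialLinearGroup (Fin g) (ZMod 4) × E) :=
  ((Hyp.hyp g (ZMod 4)).comp (MonoidHom.fst _ _)).eqLocus (p.comp (MonoidHom.snd _ _))

/-- The hyperbolization homomorphism lifts to every central extension of the symplectic group. -/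
theorem exists_hyp_lift (hg : 5 ≤ g) (hp : ∀ z, p z = 1 → ∀ e, Commute z e)
    (hs : Function.Surjective p) :
    ∃ σ : Matrix.SpecialLinearGroup (Fin g) (ZMod 4) →* E, p.comp σ = Hyp.hyp g (ZMod 4) := by
  have mem : ∀ x : pullback p, Hyp.hyp g (ZMod 4) x.1.1 = p x.1.2 := fun x => x.2
  let π : pullback p →* Matrix.SpecialLinearGroup (Fin g) (ZMod 4) :=
    (MonoidHom.fst _ _).comp (pullback p).subtype
  have hπs : Function.Surjective π := fun A => by
    obtain ⟨e, he⟩ := hs (Hyp.hyp g (ZMod 4) A)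
    exact ⟨⟨(A, e), he.symm⟩, rfl⟩
  have hπc : ∀ z, π z = 1 → ∀ e, Commute z e := by
    intro z hz e
    have hz' : z.1.1 = 1 := hz
    refine Subtype.ext (Prod.ext ?_ ?_)
    · change z.1.1 * e.1.1 = e.1.1 * z.1.1
      rw [hz', one_mul, mul_one]
    · exact hp z.1.2 (by rw [← mem, hz', map_one]) e.1.2
  obtain ⟨y, h, hy⟩ := SteinbergFamily.exists_lift hπc (by simpa using hg) hπs
  obtain ⟨ε, hε, hεc⟩ := SpElements.exists_lift_rot hp hs
  have hsnd : ∀ i j, i ≠ j → p (weyl y i j ^ 2).1.2 = p (ε i ^ 2 * ε j ^ 2) := fun i j hij => by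
    rw [← mem, map_mul, map_pow, map_pow, hε, hε]
    exact SpElements.hyp_eq_rot_sq_mul hij (SteinbergFamily.weyl_sq_smul_apply hy hij)
  have hw : ∀ i k, i ≠ k → weyl y i k ^ 4 = 1 := fun i k =>
      h.weyl_pow_four fun i j k hij hki hkj => by
    refine Subtype.ext (Prod.ext ?_ ?_)
    · change π (weyl y i j ^ 2) * π (weyl y i k ^ 2) = π (weyl y i k ^ 2) * π (weyl y i j ^ 2)
      refine SteinbergFamily.eq_of_smul_apply_eq fun v l => ?_
      simp only [mul_smul, SteinbergFamily.weyl_sq_smul_apply hy hij,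
        SteinbergFamily.weyl_sq_smul_apply hy hki.symm]
      split_ifs <;> rfl
    · have c : Commute (ε i ^ 2 * ε j ^ 2) (ε i ^ 2 * ε k ^ 2) :=
        ((Commute.refl _).mul_right (hεc i k hki.symm)).mul_left
          ((hεc j i hij.symm).mul_right (hεc j k hkj.symm))
      exact commute_of_map_eq_of_commute hp c (hsnd i j hij) (hsnd i k hki.symm)
  let G := Subgroup.closure (SteinbergFamily.gens y Set.univ)
  let ρ : G →* Matrix.SpecialLinearGroup (Fin g) (ZMod 4) := π.comp G.subtype
  have hρ : Function.Bijective ρ := by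
    constructor
    · rw [injective_iff_map_eq_one]
      exact fun x hx => Subtype.ext (h.eq_one_of_mem_closure hw hy x.1 x.2 hx)
    · rw [← MonoidHom.range_eq_top, eq_top_iff,
        ← TransvectionGeneration.closure_transvection_one, Subgroup.closure_le]
      rintro _ ⟨i, j, hij, rfl⟩
      exact ⟨⟨y i j, Subgroup.subset_closure ⟨i, trivial, j, trivial, hij, rfl⟩⟩, hy i j hij⟩
  let φ := MulEquiv.ofBijective ρ hρ
  refine ⟨((MonoidHom.snd _ _).comp (pullback p).subtype).comp
    (G.subtype.comp φ.symm.toMonoidHom), MonoidHom.ext fun A => ?_⟩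
  change p (φ.symm A).1.1.2 = _
  rw [← mem]
  exact congrArg _ (φ.apply_symm_apply A)

end HyperbolicLift

namespace GpH2

variable {Q : Type} [Group Q]

variable (Q) in
/-- The group of 2-chains modulo 2-boundaries. -/
abbrev ChainsModBoundaries := ((Q × Q) →₀ ℤ) ⧸ B2 Q

/-- The universal 2-cocycle. -/
def cocycle (a b : Q) : ChainsModBoundaries Q := (B2 Q).mkQ (Finsupp.single (a, b) 1)

theorem cocycle_mul (a b c : Q) :
    cocycle a b + cocycle (a * b) c = cocycle b c + cocycle a (b * c) := by
  have : (B2 Q).mkQ (d3 Q (Finsupp.single (a, b, c) 1)) = 0 :=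
    (Submodule.Quotient.mk_eq_zero _).2 ⟨_, rfl⟩
  simp only [d3, Finsupp.linearCombination_single, one_smul, map_sub, map_add] at this
  change cocycle b c - cocycle (a * b) c + cocycle a (b * c) - cocycle a b = 0 at this
  rw [← sub_eq_zero, ← neg_eq_zero, ← this]
  abel

theorem cocycle_one_left (a : Q) : cocycle 1 a = cocycle (1 : Q) 1 := by
  have := cocycle_mul 1 1 a
  simp only [one_mul] at this
  exact (add_right_cancel this).symm

theorem cocycle_one_right (a : Q) : cocycle a 1 = cocycle (1 : Q) 1 := by
  have := cocycle_mul a 1 1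
  simp only [mul_one] at this
  exact add_right_cancel this

variable (Q) in
/-- The central extension of `Q` defined by the universal 2-cocycle. -/
@[ext]
structure UniversalExtension where
  coeff : ChainsModBoundaries Q
  base : Q

namespace UniversalExtension

instance : Mul (UniversalExtension Q) where
  mul x y := ⟨x.coeff + y.coeff + cocycle x.base y.base, x.base * y.base⟩

instance : One (UniversalExtension Q) where
  one := ⟨-cocycle 1 1, 1⟩

instance : Inv (UniversalExtension Q) where
  inv x := ⟨-x.coeff - cocycle x.base⁻¹ x.base - cocycle 1 1, x.base⁻¹⟩

@[simp] theorem coeff_mul (x y : UniversalExtension Q) :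
    (x * y).coeff = x.coeff + y.coeff + cocycle x.base y.base := rfl

@[simp] theorem base_mul (x y : UniversalExtension Q) : (x * y).base = x.base * y.base := rfl

@[simp] theorem coeff_one : (1 : UniversalExtension Q).coeff = -cocycle 1 1 := rfl

@[simp] theorem base_one : (1 : UniversalExtension Q).base = 1 := rfl

@[simp] theorem coeff_inv (x : UniversalExtension Q) :
    x⁻¹.coeff = -x.coeff - cocycle x.base⁻¹ x.base - cocycle 1 1 := rfl

@[simp] theorem base_inv (x : UniversalExtension Q) : x⁻¹.base = x.base⁻¹ := rfl

instance : Group (UniversalExtension Q) :=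
  Group.ofLeftAxioms
    (fun x y z => by
      ext1
      · have := cocycle_mul x.base y.base z.base
        simp only [coeff_mul, base_mul]
        rw [← sub_eq_zero] at this ⊢
        rw [← this]
        abel
      · exact mul_assoc _ _ _)
    (fun x => by
      ext1
      · simp [cocycle_one_left]
      · exact one_mul _)
    (fun x => by
      ext1
      · simp only [coeff_mul, coeff_inv, base_inv, coeff_one]
        abel
      · exact inv_mul_cancel _)

variable (Q) in
/-- The projection of the universal extension. -/
def proj : UniversalExtension Q →* Q where
  toFun := base
  map_one' := rfl
  map_mul' _ _ := rfl

theorem proj_surjective : Function.Surjective (proj Q) := fun a => ⟨⟨0, a⟩, rfl⟩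

theorem commute_of_proj_eq_one (z : UniversalExtension Q) (hz : proj Q z = 1)
    (e : UniversalExtension Q) : Commute z e := by
  have hz' : z.base = 1 := hz
  refine UniversalExtension.ext ?_ ?_
  · simp only [coeff_mul, hz', cocycle_one_left, cocycle_one_right, add_comm z.coeff]
  · simp only [base_mul, hz', one_mul, mul_one]

end UniversalExtension

/-- A homomorphism that lifts to the universal extension of its target is zero on second
homology. -/
theorem H2Map_eq_zero {P : Type} [Group P] {f : P →* Q} {σ : P →* UniversalExtension Q}
    (hσ : (UniversalExtension.proj Q).comp σ = f) (x : H2 P) : H2Map f x = 0 := by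
  have hb : ∀ a, (σ a).base = f a := fun a => DFunLike.congr_fun hσ a
  let S : (P →₀ ℤ) →ₗ[ℤ] ChainsModBoundaries Q :=
    Finsupp.linearCombination ℤ fun a => -(σ a).coeff
  have key : (B2 Q).mkQ.comp (C2 f) = S.comp (d2 P) := by
    refine Finsupp.lhom_ext' fun ab => LinearMap.ext_ring ?_
    obtain ⟨a, b⟩ := ab
    have e := congrArg UniversalExtension.coeff (map_mul σ a b)
    rw [UniversalExtension.coeff_mul, hb, hb] at e
    simp only [LinearMap.comp_apply, Finsupp.lsingle_apply, C2_single, d2, S,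
      Finsupp.linearCombination_single, one_smul, map_sub, map_add]
    change cocycle (f a) (f b) = _
    rw [e]
    abel
  obtain ⟨⟨z, hz⟩, rfl⟩ := Submodule.Quotient.mk_surjective _ x
  refine (Submodule.Quotient.mk_eq_zero _).2 ?_
  change C2 f z ∈ B2 Q
  rw [← Submodule.Quotient.mk_eq_zero]
  have := LinearMap.congr_fun key z
  rw [LinearMap.comp_apply, LinearMap.comp_apply, show d2 P z = 0 from hz, map_zero] at this
  exact this

end GpH2

open GpH2 Hyp in
/-- **Theorem (Statement 9).** For `g ≥ 5`, the hyperbolization homomorphism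
`SL(g, ℤ/4ℤ) → Sp(2g, ℤ/4ℤ)` induces the zero map on second integral homology. -/
theorem hyperbolization_H2_trivial (g : ℕ) (hg : 5 ≤ g) :
    ∀ x : H2 (Matrix.SpecialLinearGroup (Fin g) (ZMod 4)),
      H2Map (hyp g (ZMod 4)) x = 0 := by
  obtain ⟨σ, hσ⟩ := exists_hyp_lift (p := UniversalExtension.proj (Sp g (ZMod 4))) hg
    UniversalExtension.commute_of_proj_eq_one UniversalExtension.proj_surjective
  exact H2Map_eq_zero hσ
end
end

section
/- Every nondegenerate symmetric bilinear form on a finitely generated free Z/4Z-module is isometric to an orthogonal direct sum of copies of the rank-one forms ⟨1⟩ and ⟨−1⟩, copies of the rank-two form ω with Gram matrix [[2,1],[1,2]], and a split form. -/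
noncomputable section

namespace BF

variable {R : Type} [CommRing R] {M M₁ M₂ : Type}
  [AddCommGroup M] [Module R M] [AddCommGroup M₁] [Module R M₁] [AddCommGroup M₂] [Module R M₂]

/-- A bilinear form is *split* if the underlying module has a direct summand `N`
with `N = N^⊥`. -/
def IsSplit (B : LinearMap.BilinForm R M) : Prop :=
  ∃ N : Submodule R M, (∃ N' : Submodule R M, IsCompl N N') ∧ N.orthogonalBilin B = N

/-- Two bilinear forms are *isometric* if there is a linear isomorphism of the underlying
modules carrying one onto the other. -/
def Isom (B₁ : LinearMap.BilinForm R M₁) (B₂ : LinearMap.BilinForm R M₂) : Prop :=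
  ∃ e : M₁ ≃ₗ[R] M₂, ∀ x y, B₂ (e x) (e y) = B₁ x y

/-- The orthogonal direct sum of two bilinear forms. -/
def prodB (B₁ : LinearMap.BilinForm R M₁) (B₂ : LinearMap.BilinForm R M₂) :
    LinearMap.BilinForm R (M₁ × M₂) :=
  B₁.compl₁₂ (LinearMap.fst R M₁ M₂) (LinearMap.fst R M₁ M₂)
    + B₂.compl₁₂ (LinearMap.snd R M₁ M₂) (LinearMap.snd R M₁ M₂)

/-- The symmetric bilinear form `ω` on `(ℤ/4ℤ)²` with Gram matrix `[[2,1],[1,2]]`. -/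
def omegaForm : LinearMap.BilinForm (ZMod 4) (Fin 2 → ZMod 4) :=
  Matrix.toLinearMap₂' (ZMod 4) !![2, 1; 1, 2]

end BF

namespace BF

section General

variable {R : Type} [CommRing R] {M M₁ M₂ M₃ M₄ : Type}
  [AddCommGroup M] [Module R M] [AddCommGroup M₁] [Module R M₁] [AddCommGroup M₂] [Module R M₂]
  [AddCommGroup M₃] [Module R M₃] [AddCommGroup M₄] [Module R M₄]
  {B : LinearMap.BilinForm R M} {B₁ : LinearMap.BilinForm R M₁} {B₂ : LinearMap.BilinForm R M₂}
  {B₃ : LinearMap.BilinForm R M₃} {B₄ : LinearMap.BilinForm R M₄}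

@[simp]
theorem prodB_apply (B₁ : LinearMap.BilinForm R M₁) (B₂ : LinearMap.BilinForm R M₂)
    (x y : M₁ × M₂) : prodB B₁ B₂ x y = B₁ x.1 y.1 + B₂ x.2 y.2 := rfl

theorem Isom.symm : Isom B₁ B₂ → Isom B₂ B₁ := fun ⟨e, he⟩ =>
  ⟨e.symm, fun x y => by rw [← he, e.apply_symm_apply, e.apply_symm_apply]⟩

theorem Isom.refl (B : LinearMap.BilinForm R M) : Isom B B := ⟨LinearEquiv.refl R M, fun _ _ => rfl⟩

theorem Isom.trans : Isom B₁ B₂ → Isom B₂ B₃ → Isom B₁ B₃ := fun ⟨e, he⟩ ⟨f, hf⟩ =>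
  ⟨e.trans f, fun x y => by rw [LinearEquiv.trans_apply, LinearEquiv.trans_apply, hf, he]⟩

theorem Isom.prodB : Isom B₁ B₂ → Isom B₃ B₄ → Isom (BF.prodB B₁ B₃) (BF.prodB B₂ B₄) :=
  fun ⟨e, he⟩ ⟨f, hf⟩ => ⟨e.prodCongr f, fun x y => by simp [he, hf]⟩

theorem isom_prodB_assoc (B₁ : LinearMap.BilinForm R M₁) (B₂ : LinearMap.BilinForm R M₂)
    (B₃ : LinearMap.BilinForm R M₃) :
    Isom (prodB (prodB B₁ B₂) B₃) (prodB B₁ (prodB B₂ B₃)) :=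
  ⟨LinearEquiv.prodAssoc R M₁ M₂ M₃, fun x y => by simp [add_assoc]⟩

theorem isom_prodB_comm (B₁ : LinearMap.BilinForm R M₁) (B₂ : LinearMap.BilinForm R M₂) :
    Isom (prodB B₁ B₂) (prodB B₂ B₁) :=
  ⟨LinearEquiv.prodComm R M₁ M₂, fun x y => by simp [add_comm]⟩

theorem isom_prodB_left_comm (B₁ : LinearMap.BilinForm R M₁) (B₂ : LinearMap.BilinForm R M₂)
    (B₃ : LinearMap.BilinForm R M₃) :
    Isom (prodB B₁ (prodB B₂ B₃)) (prodB B₂ (prodB B₁ B₃)) :=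
  (isom_prodB_assoc B₁ B₂ B₃).symm.trans
    (((isom_prodB_comm B₁ B₂).prodB (Isom.refl B₃)).trans (isom_prodB_assoc B₂ B₁ B₃))

theorem Isom.isSymm (h : Isom B₁ B₂) (hs : ∀ x y, B₁ x y = B₁ y x) (x y : M₂) :
    B₂ x y = B₂ y x := by
  obtain ⟨e, he⟩ := h.symm
  rw [← he, ← he, hs]

theorem Isom.bijective (h : Isom B₁ B₂) (hn : Function.Bijective B₁) : Function.Bijective B₂ := by
  obtain ⟨e, he⟩ := h.symm
  have : (B₂ : M₂ → _) = (e.arrowCongr (LinearEquiv.refl R R)).symm ∘ B₁ ∘ e := by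
    ext x y
    simp [he, LinearEquiv.arrowCongr]
  rw [this]
  exact (LinearEquiv.bijective _).comp (hn.comp e.bijective)

theorem Isom.isSplit (h : Isom B₁ B₂) : IsSplit B₁ → IsSplit B₂ := by
  obtain ⟨e, he⟩ := h
  rintro ⟨N, ⟨N', hc⟩, hN⟩
  refine ⟨N.map (e : M₁ →ₗ[R] M₂), ⟨N'.map (e : M₁ →ₗ[R] M₂), ?_⟩, ?_⟩
  · exact hc.map (Submodule.orderIsoMapComap e)
  · ext x
    obtain ⟨x, rfl⟩ := e.surjective x
    have := SetLike.ext_iff.1 hN x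
    rw [Submodule.mem_orthogonalBilin_iff] at this ⊢
    rw [← e.toEquiv.forall_congr_right]
    simpa [he] using this

theorem IsSplit.prodB : IsSplit B₁ → IsSplit B₂ → IsSplit (BF.prodB B₁ B₂) := by
  rintro ⟨N, ⟨N', hc⟩, hN⟩ ⟨P, ⟨P', hd⟩, hP⟩
  refine ⟨N.prod P, ⟨N'.prod P', ?_, ?_⟩, ?_⟩
  · rw [disjoint_iff, Submodule.prod_inf_prod, hc.inf_eq_bot, hd.inf_eq_bot, Submodule.prod_bot]
  · rw [codisjoint_iff, Submodule.prod_sup_prod, hc.sup_eq_top, hd.sup_eq_top, Submodule.prod_top]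
  · ext ⟨x, y⟩
    rw [Submodule.mem_prod, ← SetLike.ext_iff.1 hN x, ← SetLike.ext_iff.1 hP y]
    simp only [Submodule.mem_orthogonalBilin_iff, prodB_apply, Submodule.mem_prod, Prod.forall]
    refine ⟨fun h => ⟨fun n hn => ?_, fun p hp => ?_⟩, fun h n p hnp => ?_⟩
    · simpa using h n 0 ⟨hn, P.zero_mem⟩
    · simpa using h 0 p ⟨N.zero_mem, hp⟩
    · rw [h.1 n hnp.1, h.2 p hnp.2, add_zero]

theorem bijective_right_of_prodB (h : Function.Bijective (prodB B₁ B₂)) :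
    Function.Bijective B₂ := by
  constructor
  · rw [injective_iff_map_eq_zero]
    intro z hz
    have := (injective_iff_map_eq_zero (prodB B₁ B₂)).1 h.1 (0, z) (by ext <;> simp [hz])
    simpa using this
  · intro g
    obtain ⟨⟨c, z⟩, hz⟩ := h.2 (g ∘ₗ LinearMap.snd R M₁ M₂)
    exact ⟨z, LinearMap.ext fun w => by simpa using LinearMap.congr_fun hz (0, w)⟩

theorem bijective_prodB (h₁ : Function.Bijective B₁) (h₂ : Function.Bijective B₂) :
    Function.Bijective (prodB B₁ B₂) := by
  constructor
  · rw [injective_iff_map_eq_zero]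
    rintro ⟨x, y⟩ hxy
    refine Prod.ext ((injective_iff_map_eq_zero B₁).1 h₁.1 x ?_)
      ((injective_iff_map_eq_zero B₂).1 h₂.1 y ?_)
    · ext w
      simpa using LinearMap.congr_fun hxy (w, 0)
    · ext w
      simpa using LinearMap.congr_fun hxy (0, w)
  · intro g
    obtain ⟨x, hx⟩ := h₁.2 (g ∘ₗ LinearMap.inl R M₁ M₂)
    obtain ⟨y, hy⟩ := h₂.2 (g ∘ₗ LinearMap.inr R M₁ M₂)
    refine ⟨(x, y), ?_⟩
    ext <;> simp [hx, hy, ← Prod.zero_eq_mk]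

/-- Finitely many vectors with invertible Gram matrix span an orthogonal direct summand. -/
theorem exists_isom_prodB_of_isUnit_det {k : ℕ} (hs : ∀ x y, B x y = B y x)
    (v : Fin k → M) (G : Matrix (Fin k) (Fin k) R) (hG : ∀ i j, B (v i) (v j) = G i j)
    (hdet : IsUnit G.det) :
    ∃ K : Submodule R M, Isom B (prodB (Matrix.toLinearMap₂' R G) (B.restrict K)) := by
  let ψ : M →ₗ[R] (Fin k → R) := LinearMap.pi fun i => B (v i)
  let φ : (Fin k → R) →ₗ[R] M := Fintype.linearCombination R v
  have hφ (c : Fin k → R) : φ c = ∑ i, c i • v i := rfl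
  have hBφ (c : Fin k → R) (x : M) : B (φ c) x = ∑ i, c i * B (v i) x := by simp [hφ]
  have hψφ (c : Fin k → R) : ψ (φ c) = G.mulVec c := by
    ext i
    change B (v i) (φ c) = _
    simp [hφ, hG, Matrix.mulVec, dotProduct, mul_comm]
  have horth (c : Fin k → R) (z : M) (hz : ψ z = 0) : B (φ c) z = 0 := by
    rw [hBφ]
    exact Finset.sum_eq_zero fun i _ => by
      rw [show B (v i) z = 0 from congrFun hz i, mul_zero]
  let f : ((Fin k → R) × LinearMap.ker ψ) →ₗ[R] M := φ.coprod (LinearMap.ker ψ).subtype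
  have hf : Function.Bijective f := by
    constructor
    · rw [injective_iff_map_eq_zero]
      rintro ⟨c, z, hz⟩ h
      have h' : φ c + z = 0 := h
      have hc : c = 0 := by
        have h2 := congrArg ψ h'
        rw [map_add, hψφ, LinearMap.mem_ker.1 hz, add_zero, map_zero] at h2
        have := congrArg (G⁻¹).mulVec h2
        rwa [Matrix.mulVec_mulVec, Matrix.nonsing_inv_mul _ hdet, Matrix.one_mulVec,
          Matrix.mulVec_zero] at this
      subst hc
      have hz0 : z = 0 := by simpa using h'
      subst hz0
      rfl
    · intro x
      refine ⟨(G⁻¹.mulVec (ψ x), ⟨x - φ (G⁻¹.mulVec (ψ x)), ?_⟩), ?_⟩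
      · rw [LinearMap.mem_ker, map_sub, hψφ, Matrix.mulVec_mulVec, Matrix.mul_nonsing_inv _ hdet,
          Matrix.one_mulVec, sub_self]
      · simp [f]
  refine ⟨LinearMap.ker ψ, Isom.symm ⟨LinearEquiv.ofBijective f hf, ?_⟩⟩
  rintro ⟨c, z, hz⟩ ⟨d, w, hw⟩
  change B (φ c + z) (φ d + w) = Matrix.toLinearMap₂' R G c d + B z w
  rw [map_add B, LinearMap.add_apply, map_add, map_add, horth c w hw, hs z, horth d z hz,
    add_zero, zero_add]
  congr 1
  rw [hBφ, Matrix.toLinearMap₂'_apply', ← hψφ]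
  rfl

theorem isom_smul_one_succ (u : R) (n : ℕ) :
    Isom (prodB (Matrix.toLinearMap₂' R !![u])
        (Matrix.toLinearMap₂' R (u • 1 : Matrix (Fin n) (Fin n) R)))
      (Matrix.toLinearMap₂' R (u • 1 : Matrix (Fin (n + 1)) (Fin (n + 1)) R)) := by
  refine ⟨((LinearEquiv.funUnique (Fin 1) R R).prodCongr (LinearEquiv.refl R (Fin n → R))).trans
    (Fin.consLinearEquiv R fun _ : Fin (n + 1) => R), fun x y => ?_⟩
  simp [Matrix.toLinearMap₂'_apply', dotProduct, Fin.sum_univ_succ]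
  ring

theorem isom_blockDiagonal_succ (k : ℕ) (G : Matrix (Fin k) (Fin k) R) (n : ℕ) :
    Isom (prodB (Matrix.toLinearMap₂' R G)
        (Matrix.toLinearMap₂' R (Matrix.blockDiagonal fun _ : Fin n => G)))
      (Matrix.toLinearMap₂' R (Matrix.blockDiagonal fun _ : Fin (n + 1) => G)) := by
  let e : ((Fin k → R) × (Fin k × Fin n → R)) ≃ₗ[R] (Fin k × Fin (n + 1) → R) :=
    { toFun := fun v p => (Fin.cons (v.1 p.1) fun j => v.2 (p.1, j) : Fin (n + 1) → R) p.2
      invFun := fun w => (fun i => w (i, 0), fun p => w (p.1, p.2.succ))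
      map_add' := fun v w => by
        ext ⟨i, j⟩
        refine Fin.cases ?_ (fun j => ?_) j <;> simp
      map_smul' := fun r v => by
        ext ⟨i, j⟩
        refine Fin.cases ?_ (fun j => ?_) j <;> simp
      left_inv := fun v => by ext <;> simp
      right_inv := fun w => by
        ext ⟨i, j⟩
        refine Fin.cases ?_ (fun j => ?_) j <;> simp }
  have key (m : ℕ) (x y : Fin k × Fin m → R) :
      Matrix.toLinearMap₂' R (Matrix.blockDiagonal fun _ : Fin m => G) x y =
        ∑ l, Matrix.toLinearMap₂' R G (fun i => x (i, l)) (fun i => y (i, l)) := by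
    simp only [Matrix.toLinearMap₂'_apply, Fintype.sum_prod_type_right, Matrix.blockDiagonal_apply]
    refine Finset.sum_congr rfl fun l _ => Finset.sum_congr rfl fun i _ => ?_
    rw [Finset.sum_eq_single l (fun b _ hb => by simp [hb.symm]) (by simp)]
    simp
  refine ⟨e, fun x y => ?_⟩
  rw [key, Fin.sum_univ_succ, prodB_apply, key]
  rfl

theorem isSplit_hyperbolic (t : R) : IsSplit (Matrix.toLinearMap₂' R !![0, 1; 1, t]) := by
  refine ⟨LinearMap.ker (LinearMap.proj (R := R) (φ := fun _ : Fin 2 => R) 1),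
    ⟨LinearMap.ker (LinearMap.proj (R := R) (φ := fun _ : Fin 2 => R) 0), ?_, ?_⟩, ?_⟩
  · rw [Submodule.disjoint_def]
    intro x h1 h0
    ext i
    fin_cases i
    · exact h0
    · exact h1
  · rw [codisjoint_iff, eq_top_iff]
    intro x _
    exact Submodule.mem_sup.2 ⟨![x 0, 0], by simp, ![0, x 1], by simp, by
      ext i
      fin_cases i <;> simp⟩
  · ext x
    simp only [Submodule.mem_orthogonalBilin_iff, LinearMap.mem_ker, LinearMap.proj_apply]
    refine ⟨fun h => ?_, fun h n hn => ?_⟩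
    · simpa [Matrix.toLinearMap₂'_apply] using h ![1, 0] (by simp)
    · simp [Matrix.toLinearMap₂'_apply, h, hn]

theorem exists_isom_pi [Nontrivial R] [Module.Free R M] [Module.Finite R M]
    (B : LinearMap.BilinForm R M) :
    ∃ (m : ℕ) (σ : LinearMap.BilinForm R (Fin m → R)), Isom B σ := by
  let e := (Module.finBasis R M).equivFun
  exact ⟨_, B.compl₁₂ e.symm.toLinearMap e.symm.toLinearMap, e, fun x y => by simp⟩

end General

instance : Nontrivial (ZMod 4) := ⟨0, 1, by decide⟩

instance : IsLocalRing (ZMod 4) :=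
  .of_nonunits_add (by simp only [mem_nonunits_iff]; decide)

/-- The form `B` is an orthogonal sum of copies of `⟨1⟩`, `⟨-1⟩`, `ω` and a split form. -/
def IsDecomposable {M : Type} [AddCommGroup M] [Module (ZMod 4) M]
    (B : LinearMap.BilinForm (ZMod 4) M) : Prop :=
  ∃ (a b c m : ℕ) (σ : LinearMap.BilinForm (ZMod 4) (Fin m → ZMod 4)),
    (∀ x y, σ x y = σ y x) ∧ Function.Bijective σ ∧ IsSplit σ ∧
    Isom B
      (prodB (Matrix.toLinearMap₂' (ZMod 4) (1 : Matrix (Fin a) (Fin a) (ZMod 4)))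
        (prodB (Matrix.toLinearMap₂' (ZMod 4) (-1 : Matrix (Fin b) (Fin b) (ZMod 4)))
          (prodB
            (Matrix.toLinearMap₂' (ZMod 4)
              (Matrix.blockDiagonal fun _ : Fin c => !![2, 1; 1, 2]))
            σ)))

section ZModFour

variable {M M' : Type} [AddCommGroup M] [Module (ZMod 4) M] [AddCommGroup M'] [Module (ZMod 4) M']
  {B : LinearMap.BilinForm (ZMod 4) M} {B' : LinearMap.BilinForm (ZMod 4) M'}

theorem IsDecomposable.of_one (h : IsDecomposable B')
    (hB : Isom B (prodB (Matrix.toLinearMap₂' (ZMod 4) !![1]) B')) : IsDecomposable B := by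
  obtain ⟨a, b, c, m, σ, hs, hb, hσ, h⟩ := h
  refine ⟨a + 1, b, c, m, σ, hs, hb, hσ, hB.trans (((Isom.refl _).prodB h).trans ?_)⟩
  refine (isom_prodB_assoc _ _ _).symm.trans (Isom.prodB ?_ (Isom.refl _))
  simpa using isom_smul_one_succ (1 : ZMod 4) a

theorem IsDecomposable.of_neg_one (h : IsDecomposable B')
    (hB : Isom B (prodB (Matrix.toLinearMap₂' (ZMod 4) !![-1]) B')) : IsDecomposable B := by
  obtain ⟨a, b, c, m, σ, hs, hb, hσ, h⟩ := h
  refine ⟨a, b + 1, c, m, σ, hs, hb, hσ, hB.trans (((Isom.refl _).prodB h).trans ?_)⟩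
  refine (isom_prodB_left_comm _ _ _).trans (Isom.prodB (Isom.refl _) ?_)
  refine (isom_prodB_assoc _ _ _).symm.trans (Isom.prodB ?_ (Isom.refl _))
  simpa only [neg_smul, one_smul] using isom_smul_one_succ (-1 : ZMod 4) b

theorem IsDecomposable.of_omega (h : IsDecomposable B')
    (hB : Isom B (prodB (Matrix.toLinearMap₂' (ZMod 4) !![2, 1; 1, 2]) B')) :
    IsDecomposable B := by
  obtain ⟨a, b, c, m, σ, hs, hb, hσ, h⟩ := h
  refine ⟨a, b, c + 1, m, σ, hs, hb, hσ, hB.trans (((Isom.refl _).prodB h).trans ?_)⟩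
  refine (isom_prodB_left_comm _ _ _).trans (Isom.prodB (Isom.refl _) ?_)
  refine (isom_prodB_left_comm _ _ _).trans (Isom.prodB (Isom.refl _) ?_)
  exact (isom_prodB_assoc _ _ _).symm.trans
    (Isom.prodB (isom_blockDiagonal_succ 2 _ c) (Isom.refl _))

theorem IsDecomposable.of_isSplit (h : IsDecomposable B')
    {k : ℕ} {H : LinearMap.BilinForm (ZMod 4) (Fin k → ZMod 4)} (hHs : ∀ x y, H x y = H y x)
    (hHb : Function.Bijective H) (hH : IsSplit H) (hB : Isom B (prodB H B')) :
    IsDecomposable B := by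
  obtain ⟨a, b, c, m, σ, hs, hb, hσ, h⟩ := h
  obtain ⟨m', τ, hτ⟩ := exists_isom_pi (prodB H σ)
  refine ⟨a, b, c, m', τ, hτ.isSymm fun x y => ?_, hτ.bijective (bijective_prodB hHb hb),
    hτ.isSplit (hH.prodB hσ), hB.trans (((Isom.refl _).prodB h).trans ?_)⟩
  · rw [prodB_apply, prodB_apply, hHs, hs]
  refine (isom_prodB_left_comm _ _ _).trans (Isom.prodB (Isom.refl _) ?_)
  refine (isom_prodB_left_comm _ _ _).trans (Isom.prodB (Isom.refl _) ?_)
  exact (isom_prodB_left_comm _ _ _).trans (Isom.prodB (Isom.refl _) hτ)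

theorem isDecomposable_of_subsingleton [Subsingleton M] (B : LinearMap.BilinForm (ZMod 4) M) :
    IsDecomposable B := by
  refine ⟨0, 0, 0, 0, 0, fun _ _ => rfl, ?_, ⟨⊥, ⟨⊤, isCompl_bot_top⟩, Subsingleton.elim _ _⟩,
    ⟨0, fun x y => ?_⟩⟩
  · exact ⟨Function.injective_of_subsingleton _, fun g => ⟨0, Subsingleton.elim _ _⟩⟩
  · rw [Subsingleton.elim x 0]
    simp

theorem free_of_equiv_prod [Module.Free (ZMod 4) M] [Module.Finite (ZMod 4) M] {k : ℕ}
    {K : Submodule (ZMod 4) M} (e : M ≃ₗ[ZMod 4] (Fin k → ZMod 4) × K) :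
    Module.Free (ZMod 4) K := by
  have : Module.Projective (ZMod 4) K := .of_split
    (e.symm.toLinearMap ∘ₗ LinearMap.inr _ _ _) (LinearMap.snd _ _ _ ∘ₗ e.toLinearMap) (by
      ext; simp)
  exact Module.free_of_flat_of_isLocalRing

theorem isDecomposable_of_finrank_eq (n : ℕ) : ∀ (M : Type) [AddCommGroup M] [Module (ZMod 4) M]
    [Module.Free (ZMod 4) M] [Module.Finite (ZMod 4) M] (B : LinearMap.BilinForm (ZMod 4) M)
    (_ : ∀ x y, B x y = B y x) (_ : Function.Bijective B)
    (_ : Module.finrank (ZMod 4) M = n), IsDecomposable B := by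
  induction n using Nat.strong_induction_on with
  | _ n ih =>
  intro M _ _ _ _ B hs hb hn
  have split {k : ℕ} (hk : 0 < k) (v : Fin k → M) (G : Matrix (Fin k) (Fin k) (ZMod 4))
      (hG : ∀ i j, B (v i) (v j) = G i j) (hdet : IsUnit G.det) :
      ∃ K : Submodule (ZMod 4) M, Isom B (prodB (Matrix.toLinearMap₂' (ZMod 4) G) (B.restrict K)) ∧
        IsDecomposable (B.restrict K) := by
    obtain ⟨K, hK⟩ := exists_isom_prodB_of_isUnit_det hs v G hG hdet
    refine ⟨K, hK, ?_⟩
    obtain ⟨e, -⟩ := id hK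
    have := free_of_equiv_prod e
    have hr := e.finrank_eq
    rw [Module.finrank_prod, Module.finrank_fin_fun] at hr
    exact ih _ (by omega) K _ (fun x y => hs x y) (bijective_right_of_prodB (hK.bijective hb)) rfl
  have hcases : ∀ u : ZMod 4, u = 1 ∨ u = -1 ∨ u = 0 ∨ u = 2 := by decide
  by_cases h1 : ∃ x, B x x = 1
  · obtain ⟨x, hx⟩ := h1
    obtain ⟨K, hK, hd⟩ := split one_pos ![x] !![1] (by simp [hx]) (by simp)
    exact hd.of_one hK
  by_cases h2 : ∃ x, B x x = -1
  · obtain ⟨x, hx⟩ := h2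
    obtain ⟨K, hK, hd⟩ := split one_pos ![x] !![-1] (by simp [hx]) (by simp)
    exact hd.of_neg_one hK
  have heven (x : M) : B x x = 0 ∨ B x x = 2 :=
    ((hcases _).resolve_left fun h => h1 ⟨x, h⟩).resolve_left fun h => h2 ⟨x, h⟩
  rcases subsingleton_or_nontrivial M with hM | hM
  · exact isDecomposable_of_subsingleton B
  obtain ⟨x, y, hxy⟩ : ∃ x y, B x y = 1 := by
    let b := Module.Free.chooseBasis (ZMod 4) M
    obtain ⟨i⟩ := b.index_nonempty
    obtain ⟨x, hx⟩ := hb.2 (b.coord i)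
    exact ⟨x, b i, by simp [hx]⟩
  have hyx : B y x = 1 := by rw [hs, hxy]
  have hyper (x y : M) (hxy : B x y = 1) (hx : B x x = 0) : IsDecomposable B := by
    have hyx : B y x = 1 := by rw [hs, hxy]
    obtain ⟨K, hK, hd⟩ := split two_pos ![x, y] !![0, 1; 1, B y y]
      (by simp [Fin.forall_fin_two, hx, hxy, hyx]) (by simp [Matrix.det_fin_two])
    refine hd.of_isSplit (fun z w => ?_) (bijective_right_of_prodB
      ((hK.trans (isom_prodB_comm _ _)).bijective hb)) (isSplit_hyperbolic _) hK
    simp [Matrix.toLinearMap₂'_apply]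
    ring
  rcases heven x with hx | hx
  · exact hyper x y hxy hx
  rcases heven y with hy | hy
  · exact hyper y x hyx hy
  obtain ⟨K, hK, hd⟩ := split two_pos ![x, y] !![2, 1; 1, 2]
    (by simp [Fin.forall_fin_two, hx, hy, hxy, hyx]) (by rw [Matrix.det_fin_two]; decide)
  exact hd.of_omega hK

end ZModFour

end BF

open BF in
/-- **Theorem (Statement 10).** Every nondegenerate symmetric bilinear form on a finitely
generated free `ℤ/4ℤ`-module is isometric to an orthogonal direct sum of copies of `⟨1⟩`,
copies of `⟨-1⟩`, copies of `ω = [[2,1],[1,2]]`, and a split form. -/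
theorem zmod4_form_decomposition (M : Type) [AddCommGroup M] [Module (ZMod 4) M]
    [Module.Free (ZMod 4) M] [Module.Finite (ZMod 4) M]
    (B : LinearMap.BilinForm (ZMod 4) M) (hsymm : ∀ x y, B x y = B y x)
    (hnd : Function.Bijective B) :
    ∃ (a b c m : ℕ) (σ : LinearMap.BilinForm (ZMod 4) (Fin m → ZMod 4)),
      (∀ x y, σ x y = σ y x) ∧ Function.Bijective σ ∧ IsSplit σ ∧
      Isom B
        (prodB (Matrix.toLinearMap₂' (ZMod 4) (1 : Matrix (Fin a) (Fin a) (ZMod 4)))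
          (prodB (Matrix.toLinearMap₂' (ZMod 4) (-1 : Matrix (Fin b) (Fin b) (ZMod 4)))
            (prodB
              (Matrix.toLinearMap₂' (ZMod 4)
                (Matrix.blockDiagonal fun _ : Fin c => !![2, 1; 1, 2]))
              σ))) := by
  exact isDecomposable_of_finrank_eq _ M B hsymm hnd rfl
end
end

section
/- Let ω be the symmetric bilinear form on (Z/4Z)² with Gram matrix [[2,1],[1,2]]. Then: (a) the orthogonal sum ω ⊥ ω is split; but (b) for every split nondegenerate symmetric bilinear form σ on a finitely generated free Z/4Z-module, the orthogonal sum ω ⊥ σ is NOT split. (In particular ω represents an element of order exactly 2 in the Witt group of Z/4Z.) -/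
noncomputable section

namespace BF

/-- The real part of `i ^ v`. -/
def reI (v : ZMod 4) : ℤ := if v = 0 then 1 else if v = 2 then -1 else 0

/-- The sign `(-1) ^ v`. -/
def sgn (v : ZMod 4) : ℤ := if v = 0 ∨ v = 2 then 1 else -1

lemma reI_add_two_mul (v w : ZMod 4) : reI (v + 2 * w) = reI v * sgn w := by
  revert v w; decide

lemma sgn_eq_one {w : ZMod 4} (h : 2 * w = 0) : sgn w = 1 := by
  revert w; decide

lemma sgn_add_of_ne {v w : ZMod 4} (h : 2 * w ≠ 0) : sgn (v + w) = -sgn v := by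
  revert v w; decide

/-- The real part of the Gauss sum `∑ x, i ^ B(x, x)`. -/
def gaussSum {L : Type} [AddCommGroup L] [Module (ZMod 4) L] [Fintype L]
    (B : LinearMap.BilinForm (ZMod 4) L) : ℤ := ∑ x, reI (B x x)

section

variable {L : Type} [AddCommGroup L] [Module (ZMod 4) L]

lemma exists_two_smul_eq [Module.Free (ZMod 4) L] {x : L} (hx : (2 : ZMod 4) • x = 0) :
    ∃ y, (2 : ZMod 4) • y = x := by
  let b := Module.Free.chooseBasis (ZMod 4) L
  have half : ∀ a : ZMod 4, 2 * a = 0 → 2 * (if a = 2 then 1 else 0) = a := by decide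
  refine ⟨b.repr.symm ((b.repr x).mapRange (fun a => if a = 2 then 1 else 0) (by decide)), ?_⟩
  apply b.repr.injective
  ext i
  have hi := congrArg (fun z => b.repr z i) hx
  simp only [map_smul, Finsupp.smul_apply, smul_eq_mul, map_zero, Finsupp.zero_apply] at hi
  simpa using half _ hi

lemma gaussSum_pos_of_isSplit [Module.Free (ZMod 4) L] [Fintype L]
    {B : LinearMap.BilinForm (ZMod 4) L} (hB : ∀ x y, B x y = B y x) (h : IsSplit B) :
    0 < gaussSum B := by
  classical
  obtain ⟨N, ⟨N', hc⟩, hN⟩ := h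
  have four : (2 : ZMod 4) * 2 = 0 := by decide
  have iso : ∀ n ∈ N, ∀ m ∈ N, B n m = 0 := fun n hn m hm => by
    rw [← hN] at hm
    exact hm n hn
  have shift : ∀ (x : L) (n : N), reI (B (x + n) (x + n)) = reI (B x x) * sgn (B x n) := by
    intro x n
    rw [← reI_add_two_mul]
    congr 1
    simp only [map_add, LinearMap.add_apply, iso n n.2 n n.2, hB n x]
    ring
  have key : Fintype.card N * gaussSum B = ∑ x, reI (B x x) * ∑ n : N, sgn (B x n) := by
    simp_rw [Finset.mul_sum, ← shift]
    rw [Finset.sum_comm]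
    have : ∀ n : N, ∑ x, reI (B (x + n) (x + n)) = gaussSum B := fun n =>
      Equiv.sum_comp (Equiv.addRight (n : L)) (fun x => reI (B x x))
    simp_rw [this, Finset.sum_const, Finset.card_univ, nsmul_eq_mul]
  have even : ∀ x, (∀ n ∈ N, 2 * B x n = 0) → B x x = 0 := by
    intro x hx
    have h2 : (2 : ZMod 4) • x ∈ N := by
      rw [← hN]
      intro n hn
      change B n ((2 : ZMod 4) • x) = 0
      simpa [hB n x] using hx n hn
    obtain ⟨n, hn, m, hm, rfl⟩ :=
      Submodule.mem_sup.1 (hc.sup_eq_top ▸ Submodule.mem_top : x ∈ N ⊔ N')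
    have hm2 : (2 : ZMod 4) • m = 0 := by
      refine Submodule.disjoint_def.1 hc.disjoint _ ?_ (N'.smul_mem _ hm)
      rw [smul_add] at h2
      exact (N.add_mem_iff_right (N.smul_mem _ hn)).1 h2
    obtain ⟨y, rfl⟩ := exists_two_smul_eq hm2
    simp only [map_add, map_smul, LinearMap.add_apply, LinearMap.smul_apply, smul_eq_mul,
      iso n hn n hn, hB y n]
    linear_combination (B n y + B y y) * four
  have term : ∀ x, 0 ≤ reI (B x x) * ∑ n : N, sgn (B x n) := by
    intro x
    by_cases hx : ∀ n ∈ N, 2 * B x n = 0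
    · rw [even x hx, Finset.sum_congr rfl fun (n : N) _ => sgn_eq_one (hx n n.2)]
      simp [reI]
    · push Not at hx
      obtain ⟨m, hm, hne⟩ := hx
      have := Equiv.sum_comp (Equiv.addRight (⟨m, hm⟩ : N)) (fun n => sgn (B x n))
      simp only [Equiv.coe_addRight, Submodule.coe_add, map_add, sgn_add_of_ne hne,
        Finset.sum_neg_distrib] at this
      rw [show ∑ n : N, sgn (B x n) = 0 by omega, mul_zero]
  have pos : 0 < ∑ x, reI (B x x) * ∑ n : N, sgn (B x n) := by
    refine Finset.sum_pos' (fun x _ => term x) ⟨0, Finset.mem_univ _, ?_⟩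
    simp [reI, sgn, Fintype.card_pos]
  rw [← key] at pos
  exact pos_of_mul_pos_right pos (by positivity)

end

lemma omegaForm_apply (u v : Fin 2 → ZMod 4) :
    omegaForm u v = 2 * u 0 * v 0 + u 0 * v 1 + u 1 * v 0 + 2 * u 1 * v 1 := by
  simp [omegaForm, Matrix.toLinearMap₂'_apply, Fin.sum_univ_two]
  ring

lemma gaussSum_prodB_omegaForm {M : Type} [AddCommGroup M] [Module (ZMod 4) M] [Fintype M]
    (σ : LinearMap.BilinForm (ZMod 4) M) :
    gaussSum (prodB omegaForm σ) = -8 * gaussSum σ := by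
  have h : ∀ (u : Fin 2 → ZMod 4) (m : M), reI (prodB omegaForm σ (u, m) (u, m)) =
      sgn (u 0 * u 0 + u 0 * u 1 + u 1 * u 1) * reI (σ m m) := by
    intro u m
    rw [mul_comm, ← reI_add_two_mul]
    congr 1
    simp only [prodB, LinearMap.add_apply, LinearMap.compl₁₂_apply, LinearMap.fst_apply,
      LinearMap.snd_apply, omegaForm_apply]
    ring
  have h8 : ∑ u : Fin 2 → ZMod 4, sgn (u 0 * u 0 + u 0 * u 1 + u 1 * u 1) = -8 := by decide
  simp_rw [gaussSum, Fintype.sum_prod_type, h, ← Finset.mul_sum, ← Finset.sum_mul, h8]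

lemma isSplit_prodB_omegaForm : IsSplit (prodB omegaForm omegaForm) := by
  let f : (Fin 2 → ZMod 4) →ₗ[ZMod 4] (Fin 2 → ZMod 4) :=
    Matrix.toLin' !![1, 0; 0, -1]
  have f0 : ∀ u, f u 0 = u 0 := fun u => by simp [f, Matrix.mulVec, Matrix.vecHead, Matrix.vecTail]
  have f1 : ∀ u, f u 1 = -u 1 := fun u => by simp [f, Matrix.mulVec, Matrix.vecHead, Matrix.vecTail]
  have hB : ∀ p q, prodB omegaForm omegaForm p q = omegaForm p.1 q.1 + omegaForm p.2 q.2 :=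
    fun _ _ => rfl
  have four : (4 : ZMod 4) = 0 := by decide
  refine ⟨f.graph, ⟨LinearMap.ker (LinearMap.fst _ _ _), ?_⟩, ?_⟩
  · refine ⟨Submodule.disjoint_def.2 ?_, codisjoint_iff.2 (eq_top_iff.2 ?_)⟩
    · rintro ⟨u, w⟩ h h'
      obtain rfl : u = 0 := h'
      obtain rfl : w = f 0 := h
      simp
    · rintro ⟨u, w⟩ -
      exact Submodule.mem_sup.2 ⟨(u, f u), rfl, (0, w - f u), rfl, by simp⟩
  · ext ⟨u, w⟩
    rw [Submodule.mem_orthogonalBilin_iff, LinearMap.mem_graph_iff]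
    constructor
    · intro h
      have ha := h (![1, 0], f ![1, 0]) rfl
      have hb := h (![0, 1], f ![0, 1]) rfl
      simp only [hB, omegaForm_apply, f0, f1, Matrix.cons_val_zero,
        Matrix.cons_val_one] at ha hb
      have hw : ∀ a b c d : ZMod 4, 2 * a + b + (2 * c + d) = 0 →
          a + 2 * b - (c + 2 * d) = 0 → c = a ∧ d = -b := by decide
      obtain ⟨h0, h1⟩ := hw (u 0) (u 1) (w 0) (w 1) (by linear_combination ha)
        (by linear_combination hb)
      ext i
      fin_cases i
      · simpa [f0] using h0
      · simpa [f1] using h1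
    · rintro h ⟨x, y⟩ hy
      obtain rfl : w = f u := h
      obtain rfl : y = f x := hy
      simp only [hB, omegaForm_apply, f0, f1]
      linear_combination (x 0 * u 0 + x 1 * u 1) * four

end BF

open BF in
/-- **Theorem (Statement 11).** (a) `ω ⊥ ω` is split; (b) for every split nondegenerate
symmetric bilinear form `σ` on a finitely generated free `ℤ/4ℤ`-module, `ω ⊥ σ` is not
split. In particular `ω` has order exactly two in the Witt group of `ℤ/4ℤ`. -/
theorem omega_order_two :
    IsSplit (prodB omegaForm omegaForm) ∧
    ∀ (M : Type) [AddCommGroup M] [Module (ZMod 4) M] [Module.Free (ZMod 4) M]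
      [Module.Finite (ZMod 4) M] (σ : LinearMap.BilinForm (ZMod 4) M),
      (∀ x y, σ x y = σ y x) → Function.Bijective σ → IsSplit σ →
      ¬ IsSplit (prodB omegaForm σ) := by
  refine ⟨isSplit_prodB_omegaForm, fun M _ _ _ _ σ hσ _ hs hp => ?_⟩
  have : Fintype M := @Fintype.ofFinite M (Module.finite_of_finite (ZMod 4))
  have h₁ := gaussSum_pos_of_isSplit hσ hs
  have h₂ := gaussSum_pos_of_isSplit (fun x y => ?_) hp
  · rw [gaussSum_prodB_omegaForm] at h₂
    omega
  · simp only [prodB, LinearMap.add_apply, LinearMap.compl₁₂_apply, LinearMap.fst_apply,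
      LinearMap.snd_apply, omegaForm_apply, hσ x.2]
    ring
end
end

section
/- Let k ≥ 2 be an even integer, q = exp(πi/k) and ζ = q² = exp(2πi/k). On the complex vector space C^{(Z/kZ)²}, with canonical basis indexed by pairs x = (x₁, x₂) ∈ (Z/kZ)², define the matrices: R_a diagonal with (x, x)-entry q^{x₁²}, R_c diagonal with (x, x)-entry q^{(x₁+x₂)²}, R_e diagonal with (x, x)-entry q^{x₂²} (these powers of q are well defined for even k since q^{(x+k)²} = q^{x²}), S the matrix with (m, n)-entry k⁻¹·ζ^{−(m₁n₁ + m₂n₂)}, and R_b = S³ R_a S. Then (R_a R_b R_c)⁴ = − R_e². -/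
noncomputable section

namespace Weil

open Complex

variable (k : ℕ) [NeZero k]

/-- `q = exp(πi/k)`. -/
def q : ℂ := Complex.exp (Real.pi * Complex.I / k)

/-- `ζ = q² = exp(2πi/k)`. -/
def zeta : ℂ := q k ^ 2

/-- `R_a`: diagonal with entry `q^{x₁²}` at `x = (x₁, x₂)` (exponents computed via the
canonical integer lifts, which is unambiguous for even `k`). -/
def Ra : Matrix (ZMod k × ZMod k) (ZMod k × ZMod k) ℂ :=
  Matrix.diagonal fun x => q k ^ (x.1.val ^ 2)

/-- `R_c`: diagonal with entry `q^{(x₁+x₂)²}`. -/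
def Rc : Matrix (ZMod k × ZMod k) (ZMod k × ZMod k) ℂ :=
  Matrix.diagonal fun x => q k ^ ((x.1.val + x.2.val) ^ 2)

/-- `R_e`: diagonal with entry `q^{x₂²}`. -/
def Re : Matrix (ZMod k × ZMod k) (ZMod k × ZMod k) ℂ :=
  Matrix.diagonal fun x => q k ^ (x.2.val ^ 2)

/-- The `S`-matrix, with `(m, n)`-entry `k⁻¹ ζ^{-(m₁n₁ + m₂n₂)}`. -/
def Smat : Matrix (ZMod k × ZMod k) (ZMod k × ZMod k) ℂ := fun m n =>
  (k : ℂ)⁻¹ * zeta k ^ (-((m.1.val * n.1.val + m.2.val * n.2.val : ℕ) : ℤ))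

/-- `R_b = S³ R_a S`. -/
def Rb : Matrix (ZMod k × ZMod k) (ZMod k × ZMod k) ℂ :=
  Smat k ^ 3 * Ra k * Smat k

end Weil

namespace Weil

open ZMod

lemma exists_sq_add_sq_eq_neg_one {m : ℕ} (hm : Odd m) :
    ∃ a b : ZMod m, a ^ 2 + b ^ 2 = -1 := by
  obtain ⟨r, rfl⟩ := hm
  have hcop : (4 * r + 1).Coprime (4 * (2 * r + 1)) := by
    refine Nat.Coprime.mul_right ?_ ?_
    · have : Nat.gcd (4 * r + 1) 4 = 1 := by
        rw [Nat.gcd_comm, Nat.gcd_rec]; simp [Nat.add_mod]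
      exact this
    · have h : 2 * (2 * r + 1) = (4 * r + 1) + 1 := by ring
      have : (4 * r + 1).Coprime (2 * (2 * r + 1)) := by rw [h]; simp
      exact this.coprime_mul_left_right
  obtain ⟨p, -, hp, hpm⟩ := Nat.forall_exists_prime_gt_and_modEq 0 (by omega) hcop
  have : Fact p.Prime := ⟨hp⟩
  have h4 : p ≡ 4 * r + 1 [MOD 4] := hpm.of_mul_right _
  have hr : p ≡ 4 * r + 1 [MOD 2 * r + 1] := hpm.of_mul_left _
  obtain ⟨a, b, hab⟩ := Nat.Prime.sq_add_sq (p := p) (by unfold Nat.ModEq at h4; omega)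
  refine ⟨a, b, ?_⟩
  have h1 : ((a ^ 2 + b ^ 2 : ℕ) : ZMod (2 * r + 1)) = ((4 * r + 1 : ℕ) : ZMod (2 * r + 1)) := by
    rw [hab]; exact (ZMod.natCast_eq_natCast_iff _ _ _).2 hr
  have h2 : ((2 * r + 1 : ℕ) : ZMod (2 * r + 1)) = 0 := ZMod.natCast_self _
  push_cast at h1 h2
  linear_combination h1 + 2 * h2

lemma sum_stdAddChar_mul {k : ℕ} [NeZero k] (b : ZMod k) :
    ∑ x : ZMod k, stdAddChar (x * b) = if b = 0 then (k : ℂ) else 0 := by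
  rw [AddChar.sum_mulShift b (isPrimitive_stdAddChar k)]
  split_ifs <;> simp

/-- The fourth power of a quadratic Gauss sum of odd modulus. -/
lemma gaussSum_odd_pow_four {m : ℕ} [NeZero m] (hm : Odd m) {c : ZMod m} (hc : IsUnit c) :
    (∑ x : ZMod m, stdAddChar (c * x ^ 2)) ^ 4 = (m : ℂ) ^ 2 := by
  set H := ∑ x : ZMod m, stdAddChar (c * x ^ 2) with hH
  set H' := ∑ x : ZMod m, stdAddChar (-(c * x ^ 2)) with hH'
  have hsq : H ^ 2 = H' ^ 2 := by
    obtain ⟨a, b, hab⟩ := exists_sq_add_sq_eq_neg_one hm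
    rw [sq, sq, hH, hH', Fintype.sum_mul_sum, Fintype.sum_mul_sum, ← Fintype.sum_prod_type',
      ← Fintype.sum_prod_type']
    let e : ZMod m × ZMod m ≃ ZMod m × ZMod m :=
      { toFun := fun x => (a * x.1 - b * x.2, b * x.1 + a * x.2)
        invFun := fun x => (-(a * x.1 + b * x.2), -(a * x.2 - b * x.1))
        left_inv := fun x => by
          ext
          · linear_combination (-x.1) * hab
          · linear_combination (-x.2) * hab
        right_inv := fun x => by
          ext
          · linear_combination (-x.1) * hab
          · linear_combination (-x.2) * hab }
    symm
    refine Fintype.sum_equiv e _ _ fun x => ?_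
    rw [← AddChar.map_add_eq_mul, ← AddChar.map_add_eq_mul]
    congr 1
    simp only [e, Equiv.coe_fn_mk]
    linear_combination -(c * (x.1 ^ 2 + x.2 ^ 2)) * hab
  have hmul : H * H' = m := by
    have h2 : IsUnit (2 : ZMod m) := by
      have := (ZMod.isUnit_iff_coprime 2 m).2 (Nat.coprime_two_left.2 hm)
      exact_mod_cast this
    calc H * H' = ∑ y : ZMod m, ∑ x : ZMod m, stdAddChar (c * x ^ 2) * stdAddChar (-(c * y ^ 2)) := by
          rw [hH, hH', Fintype.sum_mul_sum, Finset.sum_comm]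
      _ = ∑ y : ZMod m, ∑ t : ZMod m, stdAddChar (c * t ^ 2) * stdAddChar (y * (2 * c * t)) := by
          refine Finset.sum_congr rfl fun y _ => ?_
          refine (Fintype.sum_equiv (Equiv.addRight y) _ _ fun t => ?_).symm
          rw [← AddChar.map_add_eq_mul, ← AddChar.map_add_eq_mul]
          congr 1
          simp only [Equiv.coe_addRight]
          ring
      _ = ∑ t : ZMod m, stdAddChar (c * t ^ 2) * if t = 0 then (m : ℂ) else 0 := by
          rw [Finset.sum_comm]
          refine Finset.sum_congr rfl fun t _ => ?_
          rw [← Finset.mul_sum, sum_stdAddChar_mul]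
          simp only [(h2.mul hc).mul_right_eq_zero]
      _ = m := by simp
  calc H ^ 4 = H ^ 2 * H ^ 2 := by ring
    _ = (H * H') ^ 2 := by nth_rw 2 [hsq]; ring
    _ = _ := by rw [hmul]

lemma q_ne_zero (k : ℕ) : q k ≠ 0 := Complex.exp_ne_zero _

section

variable (k : ℕ) [NeZero k]

lemma q_pow_self : q k ^ k = -1 := by
  have : (k : ℂ) ≠ 0 := NeZero.ne _
  rw [q, ← Complex.exp_nat_mul, mul_div_cancel₀ _ this, Complex.exp_pi_mul_I]

lemma q_pow_two_mul_self : q k ^ (2 * k) = 1 := by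
  rw [mul_comm, pow_mul, q_pow_self]; norm_num

lemma stdAddChar_natCast (n : ℕ) : stdAddChar (n : ZMod k) = q k ^ (2 * n) := by
  have := stdAddChar_coe (N := k) n
  rw [Int.cast_natCast] at this
  rw [this, q, ← Complex.exp_nat_mul]
  congr 1
  push_cast
  ring

lemma q_mul_left (d : ℕ) [NeZero d] [NeZero (d * k)] : q (d * k) ^ d = q k := by
  have : (d : ℂ) ≠ 0 := NeZero.ne _
  have : (k : ℂ) ≠ 0 := NeZero.ne _
  rw [q, q, ← Complex.exp_nat_mul]
  congr 1
  push_cast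
  field_simp

/-- The quadratic function `x ↦ q^{x²}` on `ℤ/kℤ`. -/
def theta (x : ZMod k) : ℂ := q k ^ (x.val ^ 2)

/-- The quadratic Gauss sum `∑ q^{x²}` over `ℤ/kℤ`. -/
def quadGaussSum : ℂ := ∑ x : ZMod k, theta k x

lemma theta_ne_zero (x : ZMod k) : theta k x ≠ 0 := pow_ne_zero _ (q_ne_zero k)

variable {k}

lemma theta_natCast (hke : Even k) (n : ℕ) : theta k n = q k ^ (n ^ 2) := by
  obtain ⟨l, hl⟩ := hke
  rw [theta, ZMod.val_natCast]
  set r := n % k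
  set t := n / k
  have hn : n ^ 2 = r ^ 2 + 2 * k * (l * t ^ 2 + r * t) := by
    have h : r + k * t = n := Nat.mod_add_div n k
    rw [← h]
    have : k * k = 2 * k * l := by rw [hl]; ring
    linear_combination t ^ 2 * this
  rw [hn, pow_add, pow_mul (q k) (2 * k), q_pow_two_mul_self, one_pow, mul_one]

lemma theta_add (hke : Even k) (x y : ZMod k) :
    theta k (x + y) = theta k x * theta k y * stdAddChar (x * y) := by
  obtain ⟨a, rfl⟩ := ZMod.natCast_zmod_surjective x
  obtain ⟨b, rfl⟩ := ZMod.natCast_zmod_surjective y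
  rw [← Nat.cast_add, ← Nat.cast_mul, theta_natCast hke, theta_natCast hke, theta_natCast hke,
    stdAddChar_natCast, ← pow_add, ← pow_add]
  ring_nf

lemma theta_sq (x : ZMod k) : theta k x ^ 2 = stdAddChar (x ^ 2) := by
  conv_rhs => rw [← ZMod.natCast_zmod_val x, ← Nat.cast_pow, stdAddChar_natCast]
  rw [theta, ← pow_mul, mul_comm]

lemma quadGaussSum_eq_sum_range :
    quadGaussSum k = ∑ n ∈ Finset.range k, q k ^ (n ^ 2) := by
  rw [quadGaussSum]
  refine Finset.sum_bij (fun x _ => x.val) (fun x _ => Finset.mem_range.2 x.val_lt)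
    (fun x _ y _ h => ZMod.val_injective k h) (fun n hn => ⟨n, Finset.mem_univ _, ?_⟩)
    (fun x _ => rfl)
  exact ZMod.val_cast_of_lt (Finset.mem_range.1 hn)

lemma sum_range_two_mul {M : Type*} [AddCommMonoid M] (f : ℕ → M) (n : ℕ) :
    ∑ i ∈ Finset.range (2 * n), f i = ∑ i ∈ Finset.range n, (f (2 * i) + f (2 * i + 1)) := by
  induction n with
  | zero => simp
  | succ n ih =>
    rw [Nat.mul_succ, Finset.sum_range_succ, Finset.sum_range_succ, Finset.sum_range_succ, ih,
      add_assoc]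

lemma quadGaussSum_four_mul {j : ℕ} [NeZero j] [NeZero (4 * j)] (hj : Even j) :
    quadGaussSum (4 * j) = 2 * quadGaussSum j := by
  rw [quadGaussSum_eq_sum_range, quadGaussSum_eq_sum_range,
    show 4 * j = 2 * (j + j) by ring, sum_range_two_mul, Finset.sum_range_add,
    ← Finset.sum_add_distrib, Finset.mul_sum, show 2 * (j + j) = 4 * j by ring]
  refine Finset.sum_congr rfl fun n _ => ?_
  have hself : q (4 * j) ^ (4 * j) = -1 := q_pow_self _
  have hq : q (4 * j) ^ 4 = q j := q_mul_left j 4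
  have hj1 : q j ^ j = -1 := q_pow_self j
  obtain ⟨l, hl⟩ := hj
  have hjj : q j ^ (j ^ 2) = 1 := by
    rw [sq, pow_mul, hj1, Even.neg_one_pow ⟨l, hl⟩]
  have hjn : q j ^ (2 * j * n) = 1 := by rw [pow_mul, q_pow_two_mul_self, one_pow]
  have e1 : q (4 * j) ^ (2 * n) ^ 2 = q j ^ n ^ 2 := by
    rw [← hq, ← pow_mul]; ring_nf
  have e2 : q (4 * j) ^ (2 * (j + n)) ^ 2 = q j ^ n ^ 2 := by
    rw [show (2 * (j + n)) ^ 2 = 4 * (n ^ 2 + j ^ 2 + 2 * j * n) by ring, pow_mul, hq, pow_add,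
      pow_add, hjj, hjn, mul_one, mul_one]
  have e3 : q (4 * j) ^ (2 * (j + n) + 1) ^ 2 = -q (4 * j) ^ (2 * n + 1) ^ 2 := by
    rw [show (2 * (j + n) + 1) ^ 2 = (2 * n + 1) ^ 2 + 4 * (j ^ 2 + 2 * j * n) + 4 * j by ring,
      pow_add, pow_add, pow_mul _ 4 (_ + _), hq, hself, pow_add (q j), hjj, hjn]
    ring
  rw [e1, e2, e3]
  ring

lemma quadGaussSum_mul {d m : ℕ} [NeZero d] [NeZero m] [NeZero (d * m)] (hd : Even d)
    (hdm : d.Coprime m) :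
    quadGaussSum (d * m) =
      (∑ y : ZMod m, stdAddChar (((d / 2 : ℕ) : ZMod m) * y ^ 2)) *
        ∑ j : Fin d, (q d ^ m) ^ (j : ℕ) ^ 2 := by
  have hk : Even (d * m) := hd.mul_right m
  let φ : ZMod m × Fin d → ZMod (d * m) := fun x => ((d * x.1.val + m * x.2 : ℕ) : ZMod (d * m))
  have hφ : Function.Bijective φ := by
    rw [Fintype.bijective_iff_injective_and_card]
    refine ⟨fun x y h => ?_, by simp [ZMod.card, mul_comm]⟩
    have h := (ZMod.natCast_eq_natCast_iff _ _ _).1 h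
    have h1 : m * (x.2 : ℕ) ≡ m * y.2 [MOD d] := by
      simpa [Nat.ModEq, Nat.add_mod, Nat.mul_mod] using h.of_mul_right m
    have h2 : d * x.1.val ≡ d * y.1.val [MOD m] := by
      simpa [Nat.ModEq, Nat.add_mod, Nat.mul_mod] using h.of_mul_left d
    have h1 := Nat.ModEq.cancel_left_of_coprime hdm h1
    have h2 := Nat.ModEq.cancel_left_of_coprime hdm.symm h2
    ext1
    · exact ZMod.val_injective m (h2.eq_of_lt_of_lt (ZMod.val_lt _) (ZMod.val_lt _))
    · exact Fin.ext (h1.eq_of_lt_of_lt x.2.is_lt y.2.is_lt)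
  rw [quadGaussSum, ← Function.Bijective.sum_comp hφ, Fintype.sum_mul_sum, Fintype.sum_prod_type]
  refine Finset.sum_congr rfl fun y _ => Finset.sum_congr rfl fun j _ => ?_
  have : NeZero (m * d) := ⟨by rw [mul_comm]; exact NeZero.ne _⟩
  have hqd : q (d * m) ^ d = q m := q_mul_left m d
  have hqm : q (d * m) ^ m = q d := by
    have := q_mul_left d m
    rwa [mul_comm m d] at this
  obtain ⟨c, rfl⟩ := hd
  have hc : (c + c) / 2 = c := by omega
  have hy : stdAddChar ((c : ZMod m) * y ^ 2) = q m ^ (2 * (c * y.val ^ 2)) := by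
    rw [← stdAddChar_natCast]; simp
  simp only [φ]
  rw [theta_natCast hk, hc, hy, ← hqd, ← hqm, ← pow_mul, ← pow_mul, ← pow_mul, ← pow_add,
    show ((c + c) * y.val + m * (j : ℕ)) ^ 2 = (c + c) * (2 * (c * y.val ^ 2)) + m * (m * j ^ 2)
      + 2 * ((c + c) * m) * (y.val * j) by ring, pow_add, pow_mul (q _) (2 * _),
    q_pow_two_mul_self, one_pow, mul_one]

lemma quadGaussSum_pow_four_of_coprime {d m : ℕ} [NeZero d] [NeZero (d * m)] (hd : d = 2 ∨ d = 4)
    (hm : Odd m) : quadGaussSum (d * m) ^ 4 = -((d * m : ℕ) : ℂ) ^ 2 := by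
  have : NeZero m := ⟨hm.pos.ne'⟩
  have h2 : Nat.Coprime 2 m := Nat.coprime_two_left.2 hm
  have hv : (q d ^ m) ^ d = -1 := by
    rw [← pow_mul, mul_comm, pow_mul, q_pow_self, hm.neg_one_pow]
  have hunit : IsUnit ((d / 2 : ℕ) : ZMod m) := by
    rw [ZMod.isUnit_iff_coprime]
    rcases hd with rfl | rfl
    · exact Nat.coprime_one_left m
    · exact h2
  have hsum : (∑ j : Fin d, (q d ^ m) ^ (j : ℕ) ^ 2) ^ 4 = -(d : ℂ) ^ 2 := by
    generalize (q d ^ m : ℂ) = v at hv ⊢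
    rcases hd with rfl | rfl
    · simp only [Fin.sum_univ_two, Fin.val_zero, Fin.val_one]
      push_cast
      linear_combination (v ^ 2 + 4 * v + 5) * hv
    · have : ∑ j : Fin 4, v ^ (j : ℕ) ^ 2 = 2 * v := by
        simp only [Fin.sum_univ_four, Fin.val_zero, Fin.val_one, Fin.val_two,
          show ((3 : Fin 4) : ℕ) = 3 from rfl]
        linear_combination (1 - v + v ^ 5) * hv
      rw [this]
      push_cast
      linear_combination 16 * hv
  have hd2 : Even d := by rcases hd with rfl | rfl <;> decide
  have hdm : d.Coprime m := by
    rcases hd with rfl | rfl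
    · exact h2
    · exact h2.mul_left h2
  rw [quadGaussSum_mul hd2 hdm, mul_pow, gaussSum_odd_pow_four hm hunit, hsum]
  push_cast
  ring

/-- The fourth power of the quadratic Gauss sum of even modulus. -/
lemma quadGaussSum_pow_four (k : ℕ) [hk0 : NeZero k] (hke : Even k) :
    quadGaussSum k ^ 4 = -(k : ℂ) ^ 2 := by
  induction k using Nat.strong_induction_on generalizing hk0 with
  | _ k ih =>
    obtain ⟨l, hl⟩ := hke
    obtain rfl : k = 2 * l := by omega
    rcases Nat.even_or_odd l with ⟨j, hj⟩ | hl
    · obtain rfl : l = 2 * j := by omega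
      have h : 2 * (2 * j) = 4 * j := by ring
      have hj0 : j ≠ 0 := by rintro rfl; exact NeZero.ne (2 * (2 * 0)) rfl
      have : NeZero j := ⟨hj0⟩
      revert hk0 ih
      rw [h]
      intro ih hk0
      rcases Nat.even_or_odd j with hj | hj
      · rw [quadGaussSum_four_mul hj, mul_pow, ih j (by omega) hj]
        push_cast
        ring
      · exact quadGaussSum_pow_four_of_coprime (Or.inr rfl) hj
    · exact quadGaussSum_pow_four_of_coprime (Or.inl rfl) hl

lemma Smat_apply (m n : ZMod k × ZMod k) :
    Smat k m n = (k : ℂ)⁻¹ * stdAddChar (-(m.1 * n.1 + m.2 * n.2)) := by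
  have h : stdAddChar (m.1 * n.1 + m.2 * n.2) =
      q k ^ (2 * (m.1.val * n.1.val + m.2.val * n.2.val)) := by
    rw [← stdAddChar_natCast]; simp
  rw [Smat, AddChar.map_neg_eq_inv, h, zpow_neg, zpow_natCast, zeta, ← pow_mul]

lemma Smat_sq_apply (m n : ZMod k × ZMod k) :
    (Smat k ^ 2) m n = if m = -n then 1 else 0 := by
  have hk : (k : ℂ) ≠ 0 := NeZero.ne _
  rw [sq, Matrix.mul_apply, Fintype.sum_prod_type]
  have h (a b : ZMod k) : Smat k m (a, b) * Smat k (a, b) n =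
      ((k : ℂ)⁻¹ ^ 2 * stdAddChar (a * -(m.1 + n.1))) * stdAddChar (b * -(m.2 + n.2)) := by
    rw [Smat_apply, Smat_apply, mul_assoc (_ ^ 2), ← AddChar.map_add_eq_mul, mul_mul_mul_comm,
      ← AddChar.map_add_eq_mul, ← sq]
    congr 2
    ring
  simp_rw [h, ← Finset.mul_sum, ← Finset.sum_mul, ← Finset.mul_sum, sum_stdAddChar_mul, neg_eq_zero,
    add_eq_zero_iff_eq_neg, Prod.ext_iff, Prod.fst_neg, Prod.snd_neg]
  by_cases h1 : m.1 = -n.1 <;> by_cases h2 : m.2 = -n.2 <;> simp [h1, h2]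
  field_simp

lemma Smat_pow_three_apply (m n : ZMod k × ZMod k) :
    (Smat k ^ 3) m n = (k : ℂ)⁻¹ * stdAddChar (m.1 * n.1 + m.2 * n.2) := by
  rw [pow_succ, Matrix.mul_apply]
  simp_rw [Smat_sq_apply, ← neg_eq_iff_eq_neg, ite_mul, one_mul, zero_mul, Finset.sum_ite_eq,
    Finset.mem_univ, if_true, Smat_apply, Prod.fst_neg, Prod.snd_neg]
  congr 2
  ring

lemma sum_theta_mul_stdAddChar (hke : Even k) (d : ZMod k) :
    ∑ x : ZMod k, theta k x * stdAddChar (x * d) = (theta k d)⁻¹ * quadGaussSum k := by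
  rw [eq_inv_mul_iff_mul_eq₀ (theta_ne_zero k d), quadGaussSum, Finset.mul_sum]
  refine Fintype.sum_equiv (Equiv.addRight d) _ _ fun x => ?_
  rw [Equiv.coe_addRight, theta_add hke]
  ring

lemma Rb_apply (hke : Even k) (m n : ZMod k × ZMod k) :
    Rb k m n = if m.2 = n.2 then (k : ℂ)⁻¹ * quadGaussSum k * (theta k (m.1 - n.1))⁻¹ else 0 := by
  have hk : (k : ℂ) ≠ 0 := NeZero.ne _
  rw [Rb, Matrix.mul_apply, Fintype.sum_prod_type]
  have h (a b : ZMod k) : (Smat k ^ 3 * Ra k) m (a, b) * Smat k (a, b) n =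
      ((k : ℂ)⁻¹ ^ 2 * (theta k a * stdAddChar (a * (m.1 - n.1)))) *
        stdAddChar (b * (m.2 - n.2)) := by
    have e : stdAddChar (a * (m.1 - n.1)) * stdAddChar (b * (m.2 - n.2)) =
        stdAddChar (m.1 * a + m.2 * b) * stdAddChar (-(a * n.1 + b * n.2)) := by
      rw [← AddChar.map_add_eq_mul, ← AddChar.map_add_eq_mul]
      congr 1
      ring
    rw [Ra, Matrix.mul_diagonal, Smat_pow_three_apply, Smat_apply, ← theta]
    linear_combination (-(k : ℂ)⁻¹ ^ 2 * theta k a) * e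
  simp_rw [h, ← Finset.mul_sum, ← Finset.sum_mul, ← Finset.mul_sum, sum_stdAddChar_mul,
    sub_eq_zero, sum_theta_mul_stdAddChar hke]
  split_ifs
  · field_simp
  · simp

lemma Ra_mul_Rb_mul_Rc_apply (hke : Even k) (m n : ZMod k × ZMod k) :
    (Ra k * Rb k * Rc k) m n = if m.2 = n.2 then
      (k : ℂ)⁻¹ * quadGaussSum k * theta k n.2 * stdAddChar (n.1 * (m.1 + n.2)) else 0 := by
  have hc : q k ^ ((n.1.val + n.2.val) ^ 2) = theta k (n.1 + n.2) := by
    rw [← theta_natCast hke]; simp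
  rw [Ra, Rc, Matrix.mul_diagonal, Matrix.diagonal_mul, Rb_apply hke, ← theta, hc]
  split_ifs with h
  · have h1 := theta_add hke (m.1 - n.1) n.1
    rw [sub_add_cancel] at h1
    have h2 : stdAddChar (n.1 * (m.1 + n.2)) =
        stdAddChar ((m.1 - n.1) * n.1) * stdAddChar (n.1 ^ 2) * stdAddChar (n.1 * n.2) := by
      rw [← AddChar.map_add_eq_mul, ← AddChar.map_add_eq_mul]
      congr 1
      ring
    rw [h1, h2, theta_add hke, ← theta_sq]
    have := theta_ne_zero k (m.1 - n.1)
    field_simp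
  · simp

lemma Ra_mul_Rb_mul_Rc_sq_apply (hke : Even k) (m n : ZMod k × ZMod k) :
    ((Ra k * Rb k * Rc k) ^ 2) m n = if m.2 = n.2 ∧ m.1 = -n.1 - n.2 then
      (k : ℂ)⁻¹ * quadGaussSum k ^ 2 * theta k n.2 ^ 2 * stdAddChar (n.1 * n.2) else 0 := by
  have hk : (k : ℂ) ≠ 0 := NeZero.ne _
  rw [sq (Ra k * Rb k * Rc k), Matrix.mul_apply, Fintype.sum_prod_type]
  simp_rw [Ra_mul_Rb_mul_Rc_apply hke, ite_mul, zero_mul, Finset.sum_ite_eq, Finset.mem_univ,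
    if_true]
  by_cases h : m.2 = n.2
  · have e (x : ZMod k) : (k : ℂ)⁻¹ * quadGaussSum k * theta k n.2 * stdAddChar (x * (m.1 + n.2)) *
        ((k : ℂ)⁻¹ * quadGaussSum k * theta k n.2 * stdAddChar (n.1 * (x + n.2))) =
        ((k : ℂ)⁻¹ ^ 2 * quadGaussSum k ^ 2 * theta k n.2 ^ 2 * stdAddChar (n.1 * n.2)) *
          stdAddChar (x * (m.1 + n.2 + n.1)) := by
      have : stdAddChar (x * (m.1 + n.2)) * stdAddChar (n.1 * (x + n.2)) =
          stdAddChar (n.1 * n.2) * stdAddChar (x * (m.1 + n.2 + n.1)) := by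
        rw [← AddChar.map_add_eq_mul, ← AddChar.map_add_eq_mul]
        congr 1
        ring
      linear_combination ((k : ℂ)⁻¹ * quadGaussSum k * theta k n.2) ^ 2 * this
    have e2 : m.1 + n.2 + n.1 = 0 ↔ m.1 = -n.1 - n.2 := by
      rw [← sub_eq_zero (b := -n.1 - n.2)]
      ring_nf
    simp_rw [h, if_true, e, ← Finset.mul_sum, sum_stdAddChar_mul, e2, true_and]
    split_ifs
    · field_simp
    · simp
  · simp [h]

end

end Weil

open Weil in
/-- **Theorem (Statement 15).** For even `k ≥ 2`, `(R_a R_b R_c)⁴ = -R_e²`. -/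
theorem chain_relation_defect (k : ℕ) [NeZero k] (hk : 2 ≤ k) (hke : Even k) :
    (Ra k * Rb k * Rc k) ^ 4 = -(Re k ^ 2) := by
  have hk0 : (k : ℂ) ≠ 0 := NeZero.ne _
  ext m n
  have hsum (p : ZMod k × ZMod k) : ((Ra k * Rb k * Rc k) ^ 2) m p *
      ((Ra k * Rb k * Rc k) ^ 2) p n = if p = (-n.1 - n.2, n.2) then
        ((Ra k * Rb k * Rc k) ^ 2) m p * ((Ra k * Rb k * Rc k) ^ 2) p n else 0 := by
    split_ifs with h
    · rfl
    · rw [Ra_mul_Rb_mul_Rc_sq_apply hke p n, if_neg, mul_zero]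
      exact fun h' => h (Prod.ext h'.2 h'.1)
  rw [show 4 = 2 + 2 from rfl, pow_add, Matrix.mul_apply, Finset.sum_congr rfl fun p _ => hsum p,
    Finset.sum_ite_eq', if_pos (Finset.mem_univ _), Ra_mul_Rb_mul_Rc_sq_apply hke,
    Ra_mul_Rb_mul_Rc_sq_apply hke, Re, Matrix.diagonal_pow, Matrix.neg_apply]
  by_cases h : m = n
  · subst h
    have hchar : theta k m.2 ^ 2 * (ZMod.stdAddChar ((-m.1 - m.2) * m.2) *
        ZMod.stdAddChar (m.1 * m.2)) = 1 := by
      rw [theta_sq, ← AddChar.map_add_eq_mul, ← AddChar.map_add_eq_mul,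
        ← AddChar.map_zero_eq_one (ZMod.stdAddChar (N := k))]
      congr 1
      ring
    have hG := quadGaussSum_pow_four k hke
    have hG' : (k : ℂ)⁻¹ ^ 2 * quadGaussSum k ^ 4 = -1 := by
      rw [hG]; field_simp
    rw [if_pos (by simp), if_pos (by simp), Matrix.diagonal_apply_eq, Pi.pow_apply, ← theta]
    linear_combination (k : ℂ)⁻¹ ^ 2 * quadGaussSum k ^ 4 * theta k m.2 ^ 2 * hchar +
      theta k m.2 ^ 2 * hG'
  · rw [Matrix.diagonal_apply_ne _ h, neg_zero, if_neg, zero_mul]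
    rintro ⟨h2, h1⟩
    refine h (Prod.ext ?_ h2)
    rw [h1]
    ring
end
end
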